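/- arXiv:2109.01477 — 2 statements merged into one kernel-verified Lean document; each statement's English description precedes it below -/
import Mathlib

section
/- Lerch-type formula in ℚ(i): let x, y be real numbers with x > 0. The series Λ*(s) = ∑_{m=0}^∞ (−1)^{m+1} ((m+x)² + y²)^{−s} converges for Re(s) > 0 and admits an analytic continuation F to the half-plane {s ∈ ℂ : Re(s) > −1/2}, and for any such analytic continuation F one has exp(F′(0)) = (π/2) / (Γ̃(x+iy) · Γ̃(x−iy)). (This is the zeta-regularized identity ∏_{m=0}^∞ ((m+x)²+y²)^{(−1)^m} = (π/2) / (Γ̃(x+iy)Γ̃(x−iy)).) -/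
open Filter Finset Topology

/-- The modified Euler constant `γ̃₀ = 1/2 + (1/2)·∑_{j=1}^∞ (−1)^{j+1}/(j(j+1))`
(reindexed over `j : ℕ` starting at `0`). -/
noncomputable def gammaTilde0 : ℝ :=
  1 / 2 + (1 / 2) * ∑' j : ℕ, (-1 : ℝ) ^ j / ((j + 1) * (j + 2))

/-- The modified gamma function
`Γ̃(z) = z⁻¹ · exp(γ̃₀ z) · lim_{N→∞} ∏_{m=1}^N (exp(−z/m)(1+z/m))^{(−1)^{m+1}}`. -/
noncomputable def gammaTilde (z : ℂ) : ℂ :=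
  z⁻¹ * Complex.exp ((gammaTilde0 : ℂ) * z) *
    limUnder atTop (fun N : ℕ =>
      ∏ m ∈ Finset.Icc 1 N,
        (Complex.exp (-z / (m : ℂ)) * (1 + z / (m : ℂ))) ^ ((-1 : ℤ) ^ (m + 1)))

theorem tendsto_atTop_of_two_mul {α : Type*} {l : Filter α} {u : ℕ → α}
    (he : Tendsto (fun n => u (2 * n)) atTop l) (ho : Tendsto (fun n => u (2 * n + 1)) atTop l) :
    Tendsto u atTop l := by
  intro s hs
  obtain ⟨a, ha⟩ := mem_atTop_sets.1 (he hs)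
  obtain ⟨b, hb⟩ := mem_atTop_sets.1 (ho hs)
  refine mem_atTop_sets.2 ⟨2 * max a b, fun n hn => ?_⟩
  rcases Nat.even_or_odd' n with ⟨k, rfl | rfl⟩
  · exact ha k (by omega)
  · exact hb k (by omega)

theorem add_ofReal_ne_zero_of_re_pos {z : ℂ} (hz : 0 < z.re) {t : ℝ} (ht : 0 ≤ t) :
    z + t ≠ 0 := by
  intro h
  have := congrArg Complex.re h
  simp at this
  linarith

theorem add_natCast_ne_zero_of_re_pos {z : ℂ} (hz : 0 < z.re) (n : ℕ) : z + n ≠ 0 := by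
  have := add_ofReal_ne_zero_of_re_pos hz (Nat.cast_nonneg (α := ℝ) n)
  simpa using this

/-- The quotient of Gamma values to which the alternating products
`∏ j ≤ n, (z + 2j) / (z + 2j + 1)` are asymptotic, up to a factor `√n`. -/
noncomputable def gammaHalfRatio (z : ℂ) : ℂ :=
  Complex.Gamma ((z + 1) / 2) / Complex.Gamma (z / 2)

theorem gammaHalfRatio_ne_zero {z : ℂ} (hz : 0 < z.re) : gammaHalfRatio z ≠ 0 := by
  refine div_ne_zero (Complex.Gamma_ne_zero_of_re_pos ?_) (Complex.Gamma_ne_zero_of_re_pos ?_)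
  · simp; linarith
  · simp; linarith

theorem gammaHalfRatio_one : gammaHalfRatio 1 = ((√Real.pi : ℝ) : ℂ)⁻¹ := by
  have h : (Complex.Gamma (1 / 2) : ℂ) = ((√Real.pi : ℝ) : ℂ) := by
    rw [← Real.Gamma_one_half_eq, ← Complex.Gamma_ofReal]
    norm_num
  rw [gammaHalfRatio, h]
  norm_num

theorem tendsto_prod_even_div_odd {z : ℂ} (hz : 0 < z.re) :
    Tendsto (fun n : ℕ => ((√(n : ℝ) : ℝ) : ℂ) *
      ∏ j ∈ range (n + 1), (z + 2 * j) / (z + 2 * j + 1)) atTop (𝓝 (gammaHalfRatio z)) := by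
  have hΓ : Complex.Gamma (z / 2) ≠ 0 :=
    Complex.Gamma_ne_zero_of_re_pos (by simp; linarith)
  refine ((Complex.GammaSeq_tendsto_Gamma ((z + 1) / 2)).div
    (Complex.GammaSeq_tendsto_Gamma (z / 2)) hΓ).congr' ?_
  filter_upwards [eventually_gt_atTop 0] with n hn
  have hn' : (n : ℂ) ≠ 0 := by exact_mod_cast hn.ne'
  have hsqrt : (n : ℂ) ^ ((z + 1) / 2) = (n : ℂ) ^ (z / 2) * ((√(n : ℝ) : ℝ) : ℂ) := by
    rw [add_div, Complex.cpow_add _ _ hn', Real.sqrt_eq_rpow,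
      Complex.ofReal_cpow (Nat.cast_nonneg n)]
    norm_num
  have hpow : (n : ℂ) ^ (z / 2) ≠ 0 := by simp [Complex.cpow_eq_zero_iff, hn']
  have hfac : ((n.factorial : ℕ) : ℂ) ≠ 0 := by exact_mod_cast n.factorial_ne_zero
  have h0 : ∀ j : ℕ, z + 2 * j ≠ 0 := fun j => by
    exact_mod_cast add_natCast_ne_zero_of_re_pos hz (2 * j)
  have h1 : ∀ j : ℕ, z + 2 * j + 1 ≠ 0 := fun j => by
    have := add_natCast_ne_zero_of_re_pos hz (2 * j + 1)
    push_cast at this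
    rwa [← add_assoc] at this
  have hp0 : ∏ j ∈ range (n + 1), (z / 2 + j) ≠ 0 := prod_ne_zero_iff.2 fun j _ h =>
    h0 j (by linear_combination 2 * h)
  have hp1 : ∏ j ∈ range (n + 1), ((z + 1) / 2 + j) ≠ 0 := prod_ne_zero_iff.2 fun j _ h =>
    h1 j (by linear_combination 2 * h)
  have hprod : ∏ j ∈ range (n + 1), (z + 2 * j) / (z + 2 * j + 1) =
      (∏ j ∈ range (n + 1), (z / 2 + j)) / ∏ j ∈ range (n + 1), ((z + 1) / 2 + j) := by
    rw [← prod_div_distrib]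
    refine prod_congr rfl fun j _ => ?_
    have : (z + 1) / 2 + j ≠ 0 := fun h => h1 j (by linear_combination 2 * h)
    rw [div_eq_div_iff (h1 j) this]
    ring
  simp only [Pi.div_apply, Complex.GammaSeq]
  rw [hprod, hsqrt]
  field_simp

theorem tendsto_alternating_harmonic :
    Tendsto (fun N : ℕ => ∑ m ∈ Icc 1 N, (-1 : ℝ) ^ (m + 1) / m) atTop (𝓝 gammaTilde0) := by
  have hs : Summable fun j : ℕ => (-1 : ℝ) ^ j / (((j : ℝ) + 1) * (j + 2)) := by
    have h2 : Summable fun j : ℕ => (((j + 1 : ℕ) : ℝ) ^ 2)⁻¹ :=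
      (summable_nat_add_iff (f := fun n : ℕ => ((n : ℝ) ^ 2)⁻¹) 1).2
        (Real.summable_nat_pow_inv.2 one_lt_two)
    refine Summable.of_norm_bounded h2 fun j => ?_
    rw [norm_div, norm_pow, norm_neg, norm_one, one_pow, one_div, Real.norm_of_nonneg (by positivity)]
    push_cast
    gcongr
    nlinarith
  have key : ∀ N : ℕ, ∑ m ∈ Icc 1 N, (-1 : ℝ) ^ (m + 1) / m =
      1 / 2 + 1 / 2 * ∑ j ∈ range N, (-1 : ℝ) ^ j / (((j : ℝ) + 1) * (j + 2))
        - (-1) ^ N * (1 / 2 * (1 / ((N : ℝ) + 1))) := by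
    intro N
    induction N with
    | zero => norm_num
    | succ N ih =>
      rw [sum_Icc_succ_top (by omega), ih, sum_range_succ]
      push_cast
      field_simp
      ring
  have h0 : Tendsto (fun N : ℕ => (-1 : ℝ) ^ N * (1 / 2 * (1 / ((N : ℝ) + 1)))) atTop (𝓝 0) := by
    refine squeeze_zero_norm (a := fun N : ℕ => 1 / 2 * (1 / ((N : ℝ) + 1))) (fun N => ?_) ?_
    · rw [norm_mul, norm_pow, norm_neg, norm_one, one_pow, one_mul,
        Real.norm_of_nonneg (by positivity)]
    · simpa using tendsto_one_div_add_atTop_nhds_zero_nat.const_mul (1 / 2 : ℝ)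
  have := ((hs.hasSum.tendsto_sum_nat.const_mul (1 / 2)).const_add (1 / 2)).sub h0
  simp only [sub_zero] at this
  exact this.congr fun N => (key N).symm

theorem gammaTilde_partial_prod_odd {z : ℂ} (hz : 0 < z.re) (n : ℕ) :
    ∏ m ∈ Icc 1 (2 * n + 1), ((1 + z / (m : ℂ))) ^ ((-1 : ℤ) ^ (m + 1)) =
      z * (∏ j ∈ range (n + 1), (z + 2 * j) / (z + 2 * j + 1))⁻¹ *
        (∏ j ∈ range (n + 1), ((1 : ℂ) + 2 * j) / (1 + 2 * j + 1))⁻¹ / (2 * (n + 1)) := by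
  have h0 : ∀ j : ℕ, z + 2 * j ≠ 0 := fun j => by
    exact_mod_cast add_natCast_ne_zero_of_re_pos hz (2 * j)
  have h1 : ∀ j : ℕ, z + 2 * j + 1 ≠ 0 := fun j => by
    have := add_natCast_ne_zero_of_re_pos hz (2 * j + 1)
    push_cast at this
    rwa [← add_assoc] at this
  have c0 : ∀ j : ℕ, (1 : ℂ) + 2 * j ≠ 0 := fun j => by norm_cast; omega
  have c1 : ∀ j : ℕ, (1 : ℂ) + 2 * j + 1 ≠ 0 := fun j => by norm_cast
  have c2 : ∀ j : ℕ, (j : ℂ) + 1 ≠ 0 := fun j => by norm_cast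
  induction n with
  | zero =>
    have := h0 0
    have := h1 0
    simp at *
    field_simp
    ring
  | succ n ih =>
    rw [show 2 * (n + 1) + 1 = 2 * n + 1 + 1 + 1 by ring, prod_Icc_succ_top (by omega),
      prod_Icc_succ_top (by omega), ih, prod_range_succ _ (n + 1), prod_range_succ _ (n + 1)]
    have e1 : (-1 : ℤ) ^ (2 * n + 1 + 1 + 1) = -1 := Odd.neg_one_pow ⟨n + 1, by ring⟩
    have e2 : (-1 : ℤ) ^ (2 * n + 1 + 1 + 1 + 1) = 1 := Even.neg_one_pow ⟨n + 2, by ring⟩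
    rw [e1, e2, zpow_one, zpow_neg_one]
    have a0 := h0 (n + 1)
    have a1 := h1 (n + 1)
    have b0 := c0 (n + 1)
    have b1 := c1 (n + 1)
    have b2 := c2 n
    have b3 := c2 (n + 1)
    have f1 : 1 + z / ((2 * n + 1 + 1 : ℕ) : ℂ) = (z + 2 * (n + 1 : ℕ)) / (2 * (n + 1)) := by
      push_cast
      rw [show (2 * (n : ℂ) + 1 + 1) = 2 * (n + 1) by ring]
      field_simp
      ring
    have f2 : 1 + z / ((2 * n + 1 + 1 + 1 : ℕ) : ℂ) =
        (z + 2 * (n + 1 : ℕ) + 1) / (1 + 2 * (n + 1 : ℕ)) := by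
      have : (2 * n + 1 + 1 + 1 : ℂ) ≠ 0 := by norm_cast
      push_cast at b0 ⊢
      rw [eq_div_iff b0]
      field_simp
      ring
    have f3 : (1 + 2 * ((n + 1 : ℕ) : ℂ) + 1) = 2 * ((n + 1 : ℕ) + 1) := by ring
    rw [f1, f2, f3]
    simp only [mul_inv, div_eq_mul_inv]
    generalize (∏ j ∈ range (n + 1), (z + 2 * (j : ℂ)) * (z + 2 * (j : ℂ) + 1)⁻¹)⁻¹ = P
    generalize (∏ j ∈ range (n + 1), (1 + 2 * (j : ℂ)) * (1 + 2 * (j : ℂ) + 1)⁻¹)⁻¹ = Q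
    simp only [inv_inv]
    field_simp

theorem tendsto_gammaTilde_partial_prod_odd {z : ℂ} (hz : 0 < z.re) :
    Tendsto (fun n : ℕ => ∏ m ∈ Icc 1 (2 * n + 1), (1 + z / (m : ℂ)) ^ ((-1 : ℤ) ^ (m + 1)))
      atTop (𝓝 (z * ((√Real.pi : ℝ) / 2 / gammaHalfRatio z))) := by
  have hz' := (tendsto_prod_even_div_odd hz).inv₀ (gammaHalfRatio_ne_zero hz)
  have h1 := (tendsto_prod_even_div_odd (z := 1) (by simp)).inv₀
    (gammaHalfRatio_ne_zero (by simp))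
  have hn : Tendsto (fun n : ℕ => (1 / 2 : ℂ) * ((n : ℂ) / ((n : ℂ) + 1))) atTop
      (𝓝 ((1 / 2) * 1)) := (tendsto_natCast_div_add_atTop (1 : ℂ)).const_mul _
  have := ((hz'.mul h1).mul hn).const_mul z
  rw [gammaHalfRatio_one] at this
  have e : z * ((√Real.pi : ℝ) / 2 / gammaHalfRatio z) =
      z * ((gammaHalfRatio z)⁻¹ * ((((√Real.pi : ℝ) : ℂ))⁻¹)⁻¹ * (1 / 2 * 1)) := by
    rw [inv_inv]; ring
  rw [e]
  refine this.congr' ?_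
  filter_upwards [eventually_gt_atTop 0] with n hn
  have hs : ((√(n : ℝ) : ℝ) : ℂ) ≠ 0 := by
    exact_mod_cast (Real.sqrt_pos.2 (by exact_mod_cast hn)).ne'
  have hsq : (n : ℂ) = ((√(n : ℝ) : ℝ) : ℂ) * ((√(n : ℝ) : ℝ) : ℂ) := by
    rw [← Complex.ofReal_mul, Real.mul_self_sqrt (Nat.cast_nonneg n)]; simp
  have hn1 : (n : ℂ) + 1 ≠ 0 := by norm_cast
  rw [gammaTilde_partial_prod_odd hz, mul_inv, mul_inv]
  generalize (∏ j ∈ range (n + 1), (z + 2 * (j : ℂ)) / (z + 2 * (j : ℂ) + 1))⁻¹ = P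
  generalize (∏ j ∈ range (n + 1), (1 + 2 * (j : ℂ)) / (1 + 2 * (j : ℂ) + 1))⁻¹ = Q
  have hsi : ((√(n : ℝ) : ℝ) : ℂ)⁻¹ * ((√(n : ℝ) : ℝ) : ℂ)⁻¹ * (n : ℂ) = 1 := by
    rw [hsq]
    field_simp
  field_simp at hsi ⊢
  rw [hsi]

theorem tendsto_gammaTilde_partial_prod {z : ℂ} (hz : 0 < z.re) :
    Tendsto (fun N : ℕ => ∏ m ∈ Icc 1 N, (1 + z / (m : ℂ)) ^ ((-1 : ℤ) ^ (m + 1)))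
      atTop (𝓝 (z * ((√Real.pi : ℝ) / 2 / gammaHalfRatio z))) := by
  have ho := tendsto_gammaTilde_partial_prod_odd hz
  refine tendsto_atTop_of_two_mul ?_ ho
  have hf : Tendsto (fun n : ℕ => 1 + z / ((2 * n + 1 : ℕ) : ℂ)) atTop (𝓝 1) := by
    have h := (tendsto_const_div_atTop_nhds_zero_nat z).comp
      (tendsto_atTop_mono (fun n : ℕ => (by omega : n ≤ 2 * n + 1)) tendsto_id)
    simpa using h.const_add (1 : ℂ)
  have := ho.div hf one_ne_zero
  rw [div_one] at this
  refine this.congr fun n => ?_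
  have hne : 1 + z / ((2 * n + 1 : ℕ) : ℂ) ≠ 0 := by
    have h2 : ((2 * n + 1 : ℕ) : ℂ) ≠ 0 := by norm_cast
    rw [show 1 + z / ((2 * n + 1 : ℕ) : ℂ) = (z + (2 * n + 1 : ℕ)) / ((2 * n + 1 : ℕ) : ℂ) by
      field_simp; ring]
    exact div_ne_zero (add_natCast_ne_zero_of_re_pos hz _) h2
  have e1 : (-1 : ℤ) ^ (2 * n + 1 + 1) = 1 := Even.neg_one_pow ⟨n + 1, by ring⟩
  rw [Pi.div_apply, prod_Icc_succ_top (by omega), e1, zpow_one, mul_div_cancel_right₀ _ hne]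

theorem gammaTilde_eq {z : ℂ} (hz : 0 < z.re) :
    gammaTilde z = (√Real.pi : ℝ) / 2 / gammaHalfRatio z := by
  have hz0 : z ≠ 0 := by rintro rfl; simp at hz
  have hH : Tendsto (fun N : ℕ =>
      Complex.exp (-z * ((∑ m ∈ Icc 1 N, (-1 : ℝ) ^ (m + 1) / m : ℝ) : ℂ)))
      atTop (𝓝 (Complex.exp (-z * (gammaTilde0 : ℂ)))) :=
    (Complex.continuous_exp.tendsto _).comp
      (((Complex.continuous_ofReal.tendsto _).comp tendsto_alternating_harmonic).const_mul (-z))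
  have h := hH.mul (tendsto_gammaTilde_partial_prod hz)
  have hlim : Tendsto (fun N : ℕ => ∏ m ∈ Finset.Icc 1 N,
      (Complex.exp (-z / (m : ℂ)) * (1 + z / (m : ℂ))) ^ ((-1 : ℤ) ^ (m + 1))) atTop
      (𝓝 (Complex.exp (-z * (gammaTilde0 : ℂ)) * (z * ((√Real.pi : ℝ) / 2 / gammaHalfRatio z)))) := by
    refine h.congr fun N => ?_
    simp only [mul_zpow]
    rw [prod_mul_distrib, Complex.ofReal_sum, mul_sum, Complex.exp_sum]
    congr 1
    refine prod_congr rfl fun m _ => ?_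
    rw [← Complex.exp_int_mul]
    push_cast
    congr 1
    ring
  rw [gammaTilde, hlim.limUnder_eq, neg_mul, Complex.exp_neg, mul_comm z (gammaTilde0 : ℂ)]
  have := Complex.exp_ne_zero ((gammaTilde0 : ℂ) * z)
  field_simp

theorem norm_second_difference_le {f f₁ f₂ : ℝ → ℂ} {a C : ℝ}
    (hf : ∀ t, a ≤ t → HasDerivAt f (f₁ t) t) (hf₁ : ∀ t, a ≤ t → HasDerivAt f₁ (f₂ t) t)
    (hC : ∀ t, a ≤ t → ‖f₂ t‖ ≤ C) : ‖2 * f (a + 1) - f a - f (a + 2)‖ ≤ C := by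
  have h1 : ∀ t, a ≤ t → ‖f₁ (t + 1) - f₁ t‖ ≤ C := fun t ht => by
    have := (convex_Ici a).norm_image_sub_le_of_norm_hasDerivWithin_le
      (fun u hu => (hf₁ u hu).hasDerivWithinAt) hC (x := t) (y := t + 1) ht
      (Set.mem_Ici.2 (by linarith))
    simpa using this
  have h2 := (convex_Ici a).norm_image_sub_le_of_norm_hasDerivWithin_le
    (f := fun t => f (t + 1) - f t) (f' := fun t => f₁ (t + 1) - f₁ t)
    (fun u hu => (((hf (u + 1) (by have := Set.mem_Ici.1 hu; linarith)).comp_add_const u 1).sub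
      (hf u hu)).hasDerivWithinAt) h1 (x := a) (y := a + 1) (Set.mem_Ici.2 le_rfl)
      (Set.mem_Ici.2 (by linarith))
  rw [← norm_neg]
  convert h2 using 1
  · congr 1
    rw [show a + 1 + 1 = a + 2 by ring]
    ring
  · simp

theorem sq_add_sq_pos_of_pos {x t : ℝ} (hx : 0 < x) (ht : 0 ≤ t) (y : ℝ) :
    0 < (t + x) ^ 2 + y ^ 2 := by positivity

theorem hasDerivAt_sq_add_sq_cpow {x y t : ℝ} (h : 0 < (t + x) ^ 2 + y ^ 2) (s : ℂ) :
    HasDerivAt (fun t : ℝ => (((t + x) ^ 2 + y ^ 2 : ℝ) : ℂ) ^ s)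
      (s * (((t + x) ^ 2 + y ^ 2 : ℝ) : ℂ) ^ (s - 1) * (2 * (t + x) : ℝ)) t := by
  have h1 : HasDerivAt (fun t : ℝ => (t + x) ^ 2 + y ^ 2) (2 * (t + x)) t := by
    simpa using (((hasDerivAt_id t).add_const x).pow 2).add_const (y ^ 2)
  have h2 : HasDerivAt (fun w : ℂ => w ^ s) _ (((t + x) ^ 2 + y ^ 2 : ℝ) : ℂ) :=
    (hasDerivAt_id _).cpow_const (Complex.ofReal_mem_slitPlane.2 h)
  rw [mul_one] at h2
  exact h2.comp t h1.ofReal_comp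

/-- Minus the second difference at `2k` of `m ↦ ((m + x)² + y²)⁻ˢ`. -/
noncomputable def lerchTerm (x y : ℝ) (k : ℕ) (s : ℂ) : ℂ :=
  2 * ((((2 * k + 1 : ℝ) + x) ^ 2 + y ^ 2 : ℝ) : ℂ) ^ (-s) -
    ((((2 * k : ℝ) + x) ^ 2 + y ^ 2 : ℝ) : ℂ) ^ (-s) -
    ((((2 * k + 2 : ℝ) + x) ^ 2 + y ^ 2 : ℝ) : ℂ) ^ (-s)

theorem norm_lerchTerm_le {x : ℝ} (hx : 0 < x) (y : ℝ) {R δ : ℝ} (hδ : 0 < δ) {s : ℂ}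
    (hs : ‖s‖ ≤ R) (hsδ : δ ≤ 2 * s.re + 1) (k : ℕ) :
    ‖lerchTerm x y k s‖ ≤ (4 * R * (R + 1) + 2 * R) * (min 1 x) ^ (-(2 * R + 2)) *
      ((k : ℝ) + 1) ^ (-(1 + δ)) := by
  have hR : 0 ≤ R := (norm_nonneg s).trans hs
  have hk : (0 : ℝ) ≤ k := Nat.cast_nonneg k
  have hpos : ∀ t : ℝ, 2 * (k : ℝ) ≤ t → 0 < (t + x) ^ 2 + y ^ 2 := fun t ht =>
    sq_add_sq_pos_of_pos hx (by linarith) y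
  refine norm_second_difference_le (a := 2 * (k : ℝ))
    (f := fun t : ℝ => (((t + x) ^ 2 + y ^ 2 : ℝ) : ℂ) ^ (-s))
    (fun t ht => hasDerivAt_sq_add_sq_cpow (hpos t ht) (-s))
    (fun t ht => (((hasDerivAt_sq_add_sq_cpow (hpos t ht) (-s - 1)).const_mul (-s)).mul
      (((hasDerivAt_id t).add_const x).const_mul 2).ofReal_comp)) (fun t ht => ?_)
  have hA := hpos t ht
  have htx : 0 < t + x := by linarith
  set A := (t + x) ^ 2 + y ^ 2 with hAdef
  have n1 : ‖(A : ℂ) ^ (-s - 1)‖ = A ^ (-s.re - 1) := by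
    rw [Complex.norm_cpow_eq_rpow_re_of_pos hA]; simp
  have n2 : ‖(A : ℂ) ^ (-s - 1 - 1)‖ = A ^ (-s.re - 1 - 1) := by
    rw [Complex.norm_cpow_eq_rpow_re_of_pos hA]; simp
  have n3 : ‖-s‖ ≤ R := by rwa [norm_neg]
  have n4 : ‖-s - 1‖ ≤ R + 1 := (norm_sub_le _ _).trans (by simpa using hs)
  have hA1 : A ^ (-s.re - 1 - 1) * (t + x) ^ 2 ≤ A ^ (-s.re - 1) := by
    calc A ^ (-s.re - 1 - 1) * (t + x) ^ 2 ≤ A ^ (-s.re - 1 - 1) * A := by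
          gcongr; nlinarith [sq_nonneg y]
      _ = A ^ (-s.re - 1) := by
          rw [Real.rpow_sub_one hA.ne' (-s.re - 1), div_mul_cancel₀ _ hA.ne']
  have hc : 0 < min 1 x := lt_min one_pos hx
  have hc1 : min 1 x ≤ 1 := min_le_left _ _
  have hlow : min 1 x * ((k : ℝ) + 1) ≤ t + x := by
    nlinarith [min_le_right 1 x, mul_le_mul_of_nonneg_right hc1 hk]
  have hre : s.re ≤ R := (Complex.re_le_norm s).trans hs
  have hA2 : A ^ (-s.re - 1) ≤ (min 1 x) ^ (-(2 * R + 2)) * ((k : ℝ) + 1) ^ (-(1 + δ)) := by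
    calc A ^ (-s.re - 1) ≤ ((min 1 x * ((k : ℝ) + 1)) ^ 2) ^ (-s.re - 1) := by
          apply Real.rpow_le_rpow_of_nonpos (by positivity) _ (by linarith)
          have : (min 1 x * ((k : ℝ) + 1)) ^ 2 ≤ (t + x) ^ 2 := by gcongr
          nlinarith [sq_nonneg y]
      _ = (min 1 x) ^ (2 * (-s.re - 1)) * ((k : ℝ) + 1) ^ (2 * (-s.re - 1)) := by
          rw [← Real.rpow_natCast, ← Real.rpow_mul (by positivity),
            Real.mul_rpow hc.le (by positivity)]
          norm_num
      _ ≤ _ := by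
          gcongr ?_ * ?_
          · exact Real.rpow_le_rpow_of_exponent_ge hc hc1 (by linarith)
          · exact Real.rpow_le_rpow_of_exponent_le (by linarith) (by linarith)
  have hA0 : 0 ≤ A ^ (-s.re - 1) := by positivity
  calc _ ≤ R * ((R + 1) * A ^ (-s.re - 1 - 1) * (2 * (t + x))) * (2 * (t + x))
          + R * A ^ (-s.re - 1) * 2 := by
        refine (norm_add_le _ _).trans (add_le_add ?_ ?_)
        · simp only [norm_mul, n2, Complex.norm_real, Real.norm_ofNat, Real.norm_of_nonneg htx.le]
          gcongr
        · simp only [norm_mul, n1, Complex.norm_real]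
          norm_num
          gcongr
    _ = 4 * R * (R + 1) * (A ^ (-s.re - 1 - 1) * (t + x) ^ 2) + 2 * R * A ^ (-s.re - 1) := by ring
    _ ≤ 4 * R * (R + 1) * A ^ (-s.re - 1) + 2 * R * A ^ (-s.re - 1) := by gcongr
    _ = (4 * R * (R + 1) + 2 * R) * A ^ (-s.re - 1) := by ring
    _ ≤ (4 * R * (R + 1) + 2 * R) *
          ((min 1 x) ^ (-(2 * R + 2)) * ((k : ℝ) + 1) ^ (-(1 + δ))) := by gcongr
    _ = _ := by ring

theorem summable_lerchTerm_bound (c : ℝ) {δ : ℝ} (hδ : 0 < δ) :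
    Summable fun k : ℕ => c * ((k : ℝ) + 1) ^ (-(1 + δ)) := by
  have h := (summable_nat_add_iff (f := fun n : ℕ => (n : ℝ) ^ (-(1 + δ))) 1).2
    (Real.summable_nat_rpow.2 (by linarith))
  simpa using h.mul_left c

theorem hasDerivAt_sq_add_sq_cpow_neg {A : ℝ} (hA : 0 < A) (s : ℂ) :
    HasDerivAt (fun s : ℂ => (A : ℂ) ^ (-s)) (-((A : ℂ) ^ (-s) * Real.log A)) s := by
  have := (hasDerivAt_id s).neg.const_cpow (c := (A : ℂ))
    (Or.inl (Complex.ofReal_ne_zero.2 hA.ne'))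
  simpa [Complex.ofReal_log hA.le] using this

theorem hasDerivAt_lerchTerm {x : ℝ} (hx : 0 < x) (y : ℝ) (k : ℕ) (s : ℂ) :
    HasDerivAt (lerchTerm x y k)
      (2 * -(((((2 * k + 1 : ℝ) + x) ^ 2 + y ^ 2 : ℝ) : ℂ) ^ (-s) *
          Real.log (((2 * k + 1 : ℝ) + x) ^ 2 + y ^ 2)) -
        -(((((2 * k : ℝ) + x) ^ 2 + y ^ 2 : ℝ) : ℂ) ^ (-s) *
          Real.log (((2 * k : ℝ) + x) ^ 2 + y ^ 2)) -
        -(((((2 * k + 2 : ℝ) + x) ^ 2 + y ^ 2 : ℝ) : ℂ) ^ (-s) *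
          Real.log (((2 * k + 2 : ℝ) + x) ^ 2 + y ^ 2))) s :=
  (((hasDerivAt_sq_add_sq_cpow_neg (sq_add_sq_pos_of_pos hx (by positivity) y) s).const_mul 2).sub
    (hasDerivAt_sq_add_sq_cpow_neg (sq_add_sq_pos_of_pos hx (by positivity) y) s)).sub
    (hasDerivAt_sq_add_sq_cpow_neg (sq_add_sq_pos_of_pos hx (by positivity) y) s)

/-- The analytic continuation of `∑ (-1)^(m+1) ((m + x)² + y²)⁻ˢ` to `Re s > -1/2`. -/
noncomputable def lerchSeries (x y : ℝ) (s : ℂ) : ℂ :=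
  -(1 / 2) * ((x ^ 2 + y ^ 2 : ℝ) : ℂ) ^ (-s) + 1 / 2 * ∑' k : ℕ, lerchTerm x y k s

theorem exists_nhds_lerchTerm_bound {x : ℝ} (hx : 0 < x) (y : ℝ) {s : ℂ} (hs : -(1 / 2 : ℝ) < s.re) :
    ∃ U : Set ℂ, IsOpen U ∧ s ∈ U ∧ ∃ u : ℕ → ℝ, Summable u ∧
      ∀ (k : ℕ) (w : ℂ), w ∈ U → ‖lerchTerm x y k w‖ ≤ u k := by
  have hδ : 0 < s.re + 1 / 2 := by linarith
  refine ⟨{w | ‖w‖ < ‖s‖ + 1} ∩ {w | s.re + 1 / 2 < 2 * w.re + 1}, ?_, ⟨?_, ?_⟩, _,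
    summable_lerchTerm_bound _ hδ,
    fun k w hw => norm_lerchTerm_le hx y hδ (le_of_lt hw.1) (le_of_lt hw.2) k⟩
  · exact (isOpen_lt continuous_norm continuous_const).inter
      (isOpen_lt continuous_const (by fun_prop))
  · simp
  · simp only [Set.mem_ofPred_eq]; linarith

theorem summable_lerchTerm {x : ℝ} (hx : 0 < x) (y : ℝ) {s : ℂ} (hs : -(1 / 2 : ℝ) < s.re) :
    Summable fun k => lerchTerm x y k s := by
  obtain ⟨U, -, hsU, u, hu, hb⟩ := exists_nhds_lerchTerm_bound hx y hs
  exact .of_norm_bounded hu fun k => hb k s hsU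

theorem differentiableAt_tsum_lerchTerm {x : ℝ} (hx : 0 < x) (y : ℝ) {s : ℂ}
    (hs : -(1 / 2 : ℝ) < s.re) :
    DifferentiableAt ℂ (fun w => ∑' k : ℕ, lerchTerm x y k w) s := by
  obtain ⟨U, hU, hsU, u, hu, hb⟩ := exists_nhds_lerchTerm_bound hx y hs
  exact (Complex.differentiableOn_tsum_of_summable_norm hu
    (fun k w _ => (hasDerivAt_lerchTerm hx y k w).differentiableAt.differentiableWithinAt)
    hU hb).differentiableAt (hU.mem_nhds hsU)

theorem hasSum_deriv_lerchTerm {x : ℝ} (hx : 0 < x) (y : ℝ) {s : ℂ} (hs : -(1 / 2 : ℝ) < s.re) :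
    HasSum (fun k => deriv (lerchTerm x y k) s)
      (deriv (fun w => ∑' k : ℕ, lerchTerm x y k w) s) := by
  obtain ⟨U, hU, hsU, u, hu, hb⟩ := exists_nhds_lerchTerm_bound hx y hs
  exact Complex.hasSum_deriv_of_summable_norm hu
    (fun k w _ => (hasDerivAt_lerchTerm hx y k w).differentiableAt.differentiableWithinAt)
    hU hb hsU

theorem isOpen_neg_half_lt_re : IsOpen {s : ℂ | -(1 / 2 : ℝ) < s.re} :=
  isOpen_lt continuous_const Complex.continuous_re

theorem analyticOnNhd_lerchSeries {x : ℝ} (hx : 0 < x) (y : ℝ) :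
    AnalyticOnNhd ℂ (lerchSeries x y) {s : ℂ | -(1 / 2 : ℝ) < s.re} := by
  have hA : 0 < x ^ 2 + y ^ 2 := by positivity
  refine DifferentiableOn.analyticOnNhd (fun s hs => ?_) isOpen_neg_half_lt_re
  exact (((hasDerivAt_sq_add_sq_cpow_neg hA s).differentiableAt.const_mul _).add
    ((differentiableAt_tsum_lerchTerm hx y hs).const_mul _)).differentiableWithinAt

theorem sum_range_lerch_odd (x y : ℝ) (s : ℂ) (K : ℕ) :
    ∑ m ∈ range (2 * K + 1), (-1 : ℂ) ^ (m + 1) * ((((m : ℝ) + x) ^ 2 + y ^ 2 : ℝ) : ℂ) ^ (-s) =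
      -(1 / 2) * ((x ^ 2 + y ^ 2 : ℝ) : ℂ) ^ (-s) + 1 / 2 * ∑ k ∈ range K, lerchTerm x y k s -
        1 / 2 * (((((2 * K : ℕ) : ℝ) + x) ^ 2 + y ^ 2 : ℝ) : ℂ) ^ (-s) := by
  induction K with
  | zero => simp; ring
  | succ K ih =>
    rw [show 2 * (K + 1) + 1 = 2 * K + 1 + 1 + 1 by ring, sum_range_succ, sum_range_succ, ih,
      sum_range_succ _ K, lerchTerm]
    have e1 : (-1 : ℂ) ^ (2 * K + 1 + 1 + 1) = -1 := Odd.neg_one_pow ⟨K + 1, by ring⟩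
    have e2 : (-1 : ℂ) ^ (2 * K + 1 + 1) = 1 := Even.neg_one_pow ⟨K + 1, by ring⟩
    have c1 : ((2 * K + 1 : ℕ) : ℝ) = 2 * K + 1 := by push_cast; ring
    have c2 : ((2 * K + 1 + 1 : ℕ) : ℝ) = 2 * K + 2 := by push_cast; ring
    have c3 : ((2 * (K + 1) : ℕ) : ℝ) = 2 * K + 2 := by push_cast; ring
    have c4 : ((2 * K : ℕ) : ℝ) = 2 * K := by push_cast; ring
    rw [e1, e2, c1, c2, c3, c4]
    ring

theorem tendsto_sq_add_sq_cpow_neg (x y : ℝ) {s : ℂ} (hs : 0 < s.re) :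
    Tendsto (fun m : ℕ => ((((m : ℝ) + x) ^ 2 + y ^ 2 : ℝ) : ℂ) ^ (-s)) atTop (𝓝 0) := by
  have hA : Tendsto (fun m : ℕ => ((m : ℝ) + x) ^ 2 + y ^ 2) atTop atTop :=
    tendsto_atTop_add_const_right _ _ ((tendsto_pow_atTop two_ne_zero).comp
      (tendsto_atTop_add_const_right _ x tendsto_natCast_atTop_atTop))
  rw [tendsto_zero_iff_norm_tendsto_zero]
  refine ((tendsto_rpow_neg_atTop hs).comp hA).congr' ?_
  filter_upwards [hA.eventually_gt_atTop 0] with m hm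
  rw [Complex.norm_cpow_eq_rpow_re_of_pos hm]
  simp

theorem tendsto_lerchSeries {x : ℝ} (hx : 0 < x) (y : ℝ) {s : ℂ} (hs : 0 < s.re) :
    Tendsto (fun N : ℕ => ∑ m ∈ Finset.range N,
      (-1 : ℂ) ^ (m + 1) * ((((m : ℝ) + x) ^ 2 + y ^ 2 : ℝ) : ℂ) ^ (-s))
      atTop (𝓝 (lerchSeries x y s)) := by
  have h0 : Tendsto (fun K : ℕ => (((((2 * K : ℕ) : ℝ) + x) ^ 2 + y ^ 2 : ℝ) : ℂ) ^ (-s))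
      atTop (𝓝 0) := (tendsto_sq_add_sq_cpow_neg x y hs).comp
    (tendsto_atTop_mono (fun n : ℕ => (by omega : n ≤ 2 * n)) tendsto_id)
  have hodd : Tendsto (fun K : ℕ => ∑ m ∈ Finset.range (2 * K + 1),
      (-1 : ℂ) ^ (m + 1) * ((((m : ℝ) + x) ^ 2 + y ^ 2 : ℝ) : ℂ) ^ (-s))
      atTop (𝓝 (lerchSeries x y s)) := by
    simp only [sum_range_lerch_odd]
    have := ((((summable_lerchTerm hx y (s := s) (by linarith)).hasSum.tendsto_sum_nat.const_mul
      (1 / 2)).const_add (-(1 / 2) * ((x ^ 2 + y ^ 2 : ℝ) : ℂ) ^ (-s))).sub (h0.const_mul (1 / 2)))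
    rwa [mul_zero, sub_zero] at this
  refine tendsto_atTop_of_two_mul ?_ hodd
  have := hodd.add h0
  rw [add_zero] at this
  refine this.congr fun K => ?_
  rw [sum_range_succ, Odd.neg_one_pow ⟨K, rfl⟩]
  ring

theorem exp_half_log_add_sum {a : ℕ → ℝ} (ha : ∀ m, 0 < a m) (K : ℕ) :
    Real.exp (1 / 2 * Real.log (a 0) + 1 / 2 * ∑ k ∈ range K,
      (Real.log (a (2 * k)) + Real.log (a (2 * k + 2)) - 2 * Real.log (a (2 * k + 1)))) =
    (∏ k ∈ range K, a (2 * k) / a (2 * k + 1)) * √(a (2 * K)) := by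
  have hsq : ∀ m, √(a m) = Real.exp (1 / 2 * Real.log (a m)) := fun m => by
    rw [Real.sqrt_eq_rpow, Real.rpow_def_of_pos (ha m), mul_comm]
  have hprod : ∏ k ∈ range K, a (2 * k) / a (2 * k + 1) =
      Real.exp (∑ k ∈ range K, (Real.log (a (2 * k)) - Real.log (a (2 * k + 1)))) := by
    rw [Real.exp_sum]
    refine prod_congr rfl fun k _ => ?_
    rw [Real.exp_sub, Real.exp_log (ha _), Real.exp_log (ha _)]
  rw [hprod, hsq, ← Real.exp_add]
  congr 1
  clear hprod
  induction K with
  | zero => simp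
  | succ K ih =>
    rw [sum_range_succ, sum_range_succ, show 2 * (K + 1) = 2 * K + 2 by ring]
    linarith

theorem tendsto_deriv_lerchSeries_zero {x : ℝ} (hx : 0 < x) (y : ℝ) :
    Tendsto (fun K : ℕ => ((1 / 2 * Real.log ((((0 : ℕ) : ℝ) + x) ^ 2 + y ^ 2) +
      1 / 2 * ∑ k ∈ range K, (Real.log ((((2 * k : ℕ) : ℝ) + x) ^ 2 + y ^ 2) +
        Real.log ((((2 * k + 2 : ℕ) : ℝ) + x) ^ 2 + y ^ 2) -
        2 * Real.log ((((2 * k + 1 : ℕ) : ℝ) + x) ^ 2 + y ^ 2)) : ℝ) : ℂ))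
      atTop (𝓝 (deriv (lerchSeries x y) 0)) := by
  have hA : 0 < x ^ 2 + y ^ 2 := by positivity
  have h0 : -(1 / 2 : ℝ) < (0 : ℂ).re := by simp
  have hd : deriv (lerchSeries x y) 0 =
      -(1 / 2) * -(((x ^ 2 + y ^ 2 : ℝ) : ℂ) ^ (-(0 : ℂ)) * Real.log (x ^ 2 + y ^ 2)) +
      1 / 2 * deriv (fun w => ∑' k : ℕ, lerchTerm x y k w) 0 :=
    (((hasDerivAt_sq_add_sq_cpow_neg hA 0).const_mul _).add
      ((differentiableAt_tsum_lerchTerm hx y h0).hasDerivAt.const_mul _)).deriv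
  rw [hd]
  refine (((hasSum_deriv_lerchTerm hx y h0).tendsto_sum_nat.const_mul (1 / 2)).const_add
    _).congr fun K => ?_
  simp only [(hasDerivAt_lerchTerm hx y _ 0).deriv]
  rw [neg_zero, Complex.cpow_zero]
  simp only [Complex.cpow_zero]
  push_cast
  rw [zero_add]
  congr 1
  · ring
  · congr 1
    refine sum_congr rfl fun k _ => ?_
    ring

theorem tendsto_sqrt_sq_add_sq_div (x y : ℝ) :
    Tendsto (fun n : ℕ => √((((2 * (n + 1) : ℕ) : ℝ) + x) ^ 2 + y ^ 2) / n) atTop (𝓝 2) := by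
  have h : Tendsto (fun n : ℕ => √((2 + (2 + x) / (n : ℝ)) ^ 2 + (y / (n : ℝ)) ^ 2)) atTop
      (𝓝 (√((2 + 0) ^ 2 + 0 ^ 2))) :=
    ((((tendsto_const_div_atTop_nhds_zero_nat (2 + x)).const_add 2).pow 2).add
      ((tendsto_const_div_atTop_nhds_zero_nat y).pow 2)).sqrt
  rw [show √((2 + 0 : ℝ) ^ 2 + 0 ^ 2) = 2 by
    rw [add_zero, zero_pow two_ne_zero, add_zero, Real.sqrt_sq two_pos.le]] at h
  refine h.congr' ?_
  filter_upwards [eventually_gt_atTop 0] with n hn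
  have hn' : (0 : ℝ) < n := by exact_mod_cast hn
  rw [eq_div_iff hn'.ne', ← Real.sqrt_sq hn'.le, ← Real.sqrt_mul (by positivity),
    Real.sqrt_sq hn'.le]
  congr 1
  push_cast
  field_simp
  ring

theorem exp_deriv_lerchSeries_zero {x : ℝ} (hx : 0 < x) (y : ℝ) :
    Complex.exp (deriv (lerchSeries x y) 0) =
      2 * (gammaHalfRatio (x + y * Complex.I) * gammaHalfRatio (x - y * Complex.I)) := by
  have h1 := (Complex.continuous_exp.tendsto _).comp (tendsto_deriv_lerchSeries_zero hx y)
  have hz : 0 < ((x : ℂ) + y * Complex.I).re := by simpa using hx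
  have hw : 0 < ((x : ℂ) - y * Complex.I).re := by simpa using hx
  have h2 := (((Complex.continuous_ofReal.tendsto _).comp (tendsto_sqrt_sq_add_sq_div x y))).mul
    ((tendsto_prod_even_div_odd hz).mul (tendsto_prod_even_div_odd hw))
  refine tendsto_nhds_unique ((tendsto_add_atTop_iff_nat 1).2 h1) ?_
  refine h2.congr' ?_
  filter_upwards [eventually_gt_atTop 0] with n hn
  have hn' : (n : ℂ) ≠ 0 := by exact_mod_cast hn.ne'
  have hsq : ((√(n : ℝ) : ℝ) : ℂ) * ((√(n : ℝ) : ℝ) : ℂ) = n := by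
    rw [← Complex.ofReal_mul, Real.mul_self_sqrt (Nat.cast_nonneg n)]; simp
  have key := exp_half_log_add_sum (a := fun m : ℕ => ((m : ℝ) + x) ^ 2 + y ^ 2)
    (fun m => sq_add_sq_pos_of_pos hx (Nat.cast_nonneg m) y) (n + 1)
  have hI : (y * Complex.I : ℂ) * (y * Complex.I) = -(y : ℂ) ^ 2 := by
    linear_combination (y : ℂ) ^ 2 * Complex.I_mul_I
  have hprod : (∏ j ∈ range (n + 1), ((x : ℂ) + y * Complex.I + 2 * j) /
      (x + y * Complex.I + 2 * j + 1)) * (∏ j ∈ range (n + 1), ((x : ℂ) - y * Complex.I + 2 * j) /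
      (x - y * Complex.I + 2 * j + 1)) =
      ((∏ k ∈ range (n + 1), ((((2 * k : ℕ) : ℝ) + x) ^ 2 + y ^ 2) /
        ((((2 * k + 1 : ℕ) : ℝ) + x) ^ 2 + y ^ 2) : ℝ) : ℂ) := by
    rw [← prod_mul_distrib, Complex.ofReal_prod]
    refine prod_congr rfl fun k _ => ?_
    rw [div_mul_div_comm]
    push_cast
    congr 1
    · linear_combination -hI
    · linear_combination -hI
  simp only [Function.comp_apply]
  rw [← Complex.ofReal_exp, key, Complex.ofReal_mul, ← hprod, Complex.ofReal_div,
    Complex.ofReal_natCast, div_mul_eq_mul_div, div_eq_iff hn', ← hsq]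
  ring

theorem eqOn_lerchSeries {x y : ℝ} (hx : 0 < x) {F : ℂ → ℂ}
    (hF : AnalyticOnNhd ℂ F {s : ℂ | -(1 / 2 : ℝ) < s.re})
    (hFs : ∀ s : ℂ, 0 < s.re → Tendsto (fun N : ℕ => ∑ m ∈ Finset.range N,
      (-1 : ℂ) ^ (m + 1) * ((((m : ℝ) + x) ^ 2 + y ^ 2 : ℝ) : ℂ) ^ (-s)) atTop (𝓝 (F s))) :
    Set.EqOn F (lerchSeries x y) {s : ℂ | -(1 / 2 : ℝ) < s.re} := by
  refine hF.eqOn_of_preconnected_of_eventuallyEq (analyticOnNhd_lerchSeries hx y)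
    (convex_halfSpace_re_gt _).isPreconnected (z₀ := 1) ?_ ?_
  · show -(1 / 2 : ℝ) < (1 : ℂ).re
    norm_num
  · filter_upwards [(isOpen_lt continuous_const Complex.continuous_re).mem_nhds
      (show (0 : ℝ) < (1 : ℂ).re by norm_num)] with s hs
    exact tendsto_nhds_unique (hFs s hs) (tendsto_lerchSeries hx y hs)

/-- Lerch-type formula in `ℚ(i)`: for real `x > 0` and real `y`, the series
`Λ*(s) = ∑_{m=0}^∞ (−1)^{m+1}((m+x)²+y²)^{−s}` converges for `Re(s) > 0`, extends
analytically to `{Re(s) > −1/2}`, and for any such continuation `F` one has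
`exp(F′(0)) = (π/2) / (Γ̃(x+iy)·Γ̃(x−iy))`. -/
theorem lerch_type_gaussian (x y : ℝ) (hx : 0 < x) :
    (∀ s : ℂ, 0 < s.re → ∃ L : ℂ,
      Tendsto (fun N : ℕ => ∑ m ∈ Finset.range N,
        (-1 : ℂ) ^ (m + 1) * ((((m : ℝ) + x) ^ 2 + y ^ 2 : ℝ) : ℂ) ^ (-s))
        atTop (𝓝 L)) ∧
    (∃ F : ℂ → ℂ, AnalyticOnNhd ℂ F {s : ℂ | -(1 / 2 : ℝ) < s.re} ∧
      ∀ s : ℂ, 0 < s.re →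
        Tendsto (fun N : ℕ => ∑ m ∈ Finset.range N,
          (-1 : ℂ) ^ (m + 1) * ((((m : ℝ) + x) ^ 2 + y ^ 2 : ℝ) : ℂ) ^ (-s))
          atTop (𝓝 (F s))) ∧
    (∀ F : ℂ → ℂ, AnalyticOnNhd ℂ F {s : ℂ | -(1 / 2 : ℝ) < s.re} →
      (∀ s : ℂ, 0 < s.re →
        Tendsto (fun N : ℕ => ∑ m ∈ Finset.range N,
          (-1 : ℂ) ^ (m + 1) * ((((m : ℝ) + x) ^ 2 + y ^ 2 : ℝ) : ℂ) ^ (-s))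
          atTop (𝓝 (F s))) →
      Complex.exp (deriv F 0) =
        ((Real.pi / 2 : ℝ) : ℂ) /
          (gammaTilde ((x : ℂ) + (y : ℂ) * Complex.I) *
            gammaTilde ((x : ℂ) - (y : ℂ) * Complex.I))) := by
  refine ⟨fun s hs => ⟨_, tendsto_lerchSeries hx y hs⟩,
    ⟨lerchSeries x y, analyticOnNhd_lerchSeries hx y, fun s hs => tendsto_lerchSeries hx y hs⟩,
    fun F hF hFs => ?_⟩
  have hz : 0 < ((x : ℂ) + y * Complex.I).re := by simpa using hx
  have hw : 0 < ((x : ℂ) - y * Complex.I).re := by simpa using hx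
  have hd : deriv F 0 = deriv (lerchSeries x y) 0 :=
    ((eqOn_lerchSeries hx hF hFs).eventuallyEq_of_mem
      (isOpen_neg_half_lt_re.mem_nhds (show -(1 / 2 : ℝ) < (0 : ℂ).re by simp))).deriv_eq
  rw [hd, exp_deriv_lerchSeries_zero hx, gammaTilde_eq hz, gammaTilde_eq hw]
  have hπ : ((√Real.pi : ℝ) : ℂ) ≠ 0 := by
    exact_mod_cast (Real.sqrt_pos.2 Real.pi_pos).ne'
  have hsq : ((√Real.pi : ℝ) : ℂ) * ((√Real.pi : ℝ) : ℂ) = (Real.pi : ℂ) := by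
    rw [← Complex.ofReal_mul, Real.mul_self_sqrt Real.pi_pos.le]
  have := gammaHalfRatio_ne_zero hz
  have := gammaHalfRatio_ne_zero hw
  push_cast
  rw [← hsq]
  field_simp
end

section
/- Kurokawa–Wakayama type formula: let n ≥ 1 and let x, y be real numbers with x > |y|. The series Λ*(s) = ∑_{m=0}^∞ (−1)^{m+1} ((m+x)^n − y^n)^{−s} converges for Re(s) > 0 and admits an analytic continuation F to the half-plane {s ∈ ℂ : Re(s) > −1/n}, and for any such analytic continuation F one has exp(F′(0)) = (π/2)^{n/2} / ∏_{ζ : ζⁿ = 1} Γ̃(x − ζ·y), where the product runs over all n-th roots of unity ζ in ℂ. (This is the zeta-regularized identity ∏_{m=0}^∞ ((m+x)^n − y^n)^{(−1)^m} = (√(π/2))^n / ∏_{ζⁿ=1} Γ̃(x − ζy).) -/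
open Filter Finset Topology

theorem tendsto_of_tendsto_two_mul {X : Type*} [TopologicalSpace X] {f : ℕ → X} {l : X}
    (h₀ : Tendsto (fun k => f (2 * k)) atTop (𝓝 l))
    (h₁ : Tendsto (fun k => f (2 * k + 1)) atTop (𝓝 l)) : Tendsto f atTop (𝓝 l) := by
  intro s hs
  obtain ⟨a, ha⟩ := mem_atTop_sets.1 (h₀ hs)
  obtain ⟨b, hb⟩ := mem_atTop_sets.1 (h₁ hs)
  refine mem_atTop_sets.2 ⟨2 * a + 2 * b, fun m hm => ?_⟩
  obtain ⟨k, rfl | rfl⟩ := m.even_or_odd'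
  · exact ha k (by omega)
  · exact hb k (by omega)

/-- The partial sums of the second differences of `f`, with alternating signs, in terms of the
alternating partial sums of `f`. -/
theorem sum_alternating_second_difference {R : Type*} [CommRing R] (f : ℕ → R) (N : ℕ) :
    ∑ m ∈ range N, (-1) ^ m * (f m - 2 * f (m + 1) + f (m + 2)) =
      4 * ∑ m ∈ range N, (-1) ^ m * f m + (-1) ^ N * (3 * f N - f (N + 1)) -
        (3 * f 0 - f 1) := by
  induction N with
  | zero => simp
  | succ N ih =>
    rw [sum_range_succ, sum_range_succ, ih]
    ring

theorem tendsto_alternating_harmonic_gammaTilde0 :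
    Tendsto (fun N : ℕ => ∑ m ∈ range N, (-1 : ℝ) ^ m / (m + 1)) atTop (𝓝 gammaTilde0) := by
  have hs : Summable fun j : ℕ => (-1 : ℝ) ^ j / ((j + 1) * (j + 2)) := by
    refine Summable.of_norm_bounded
      ((summable_nat_add_iff 1).2 (Real.summable_one_div_nat_pow.2 one_lt_two)) fun j => ?_
    rw [norm_div, norm_pow, norm_neg, norm_one, one_pow, Real.norm_of_nonneg (by positivity)]
    push_cast
    gcongr
    nlinarith [(Nat.cast_nonneg j : (0 : ℝ) ≤ j)]
  have hpart : ∀ N : ℕ, ∑ m ∈ range N, (-1 : ℝ) ^ m / (m + 1) =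
      1 / 2 + 1 / 2 * ∑ j ∈ range N, (-1 : ℝ) ^ j / ((j + 1) * (j + 2)) -
        1 / 2 * ((-1) ^ N / (N + 1)) := by
    intro N
    induction N with
    | zero => simp
    | succ N ih =>
      rw [sum_range_succ, sum_range_succ, ih]
      have h1 : (N : ℝ) + 1 ≠ 0 := by positivity
      have h2 : (N : ℝ) + 1 + 1 ≠ 0 := by positivity
      have h3 : (N : ℝ) + 2 ≠ 0 := by positivity
      push_cast
      field_simp
      ring
  have hz : Tendsto (fun N : ℕ => (-1 : ℝ) ^ N / (N + 1)) atTop (𝓝 0) := by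
    refine squeeze_zero_norm (fun N => ?_) tendsto_one_div_add_atTop_nhds_zero_nat
    rw [norm_div, norm_pow, norm_neg, norm_one, one_pow, Real.norm_of_nonneg (by positivity)]
  simp_rw [hpart]
  have := ((hs.hasSum.tendsto_sum_nat.const_mul (1 / 2)).const_add (1 / 2)).sub
    (hz.const_mul (1 / 2))
  rwa [mul_zero, sub_zero] at this

/-- The finite product `∏_{m<2K} (m+w)^{(-1)^m}`. -/
noncomputable def alternatingProd (w : ℂ) (K : ℕ) : ℂ :=
  ∏ j ∈ range K, (2 * j + w) / (2 * j + 1 + w)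

theorem natCast_add_ne_zero_of_re_pos {w : ℂ} (hw : 0 < w.re) (k : ℕ) : (k : ℂ) + w ≠ 0 := by
  intro h
  have := congrArg Complex.re h
  simp at this
  linarith [(Nat.cast_nonneg k : (0 : ℝ) ≤ k)]

theorem tendsto_sqrt_mul_alternatingProd {w : ℂ} (hw : 0 < w.re) :
    Tendsto (fun K : ℕ => ((√(K : ℝ) : ℝ) : ℂ) * alternatingProd w K) atTop
      (𝓝 (Complex.Gamma ((w + 1) / 2) / Complex.Gamma (w / 2))) := by
  have h2 : 0 < (w / 2).re := by simpa using hw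
  have h3 : 0 < ((w + 1) / 2).re := by
    simp
    linarith
  have hΓ := (Complex.GammaSeq_tendsto_Gamma ((w + 1) / 2)).div
    (Complex.GammaSeq_tendsto_Gamma (w / 2)) (Complex.Gamma_ne_zero_of_re_pos h2)
  have hr := (tendsto_natCast_div_add_atTop (w / 2)).div
    (tendsto_natCast_div_add_atTop ((w + 1) / 2)) one_ne_zero
  have := hΓ.mul hr
  rw [div_one, mul_one] at this
  refine this.congr' ?_
  filter_upwards [eventually_gt_atTop 0] with K hK
  have hK0 : (K : ℂ) ≠ 0 := by exact_mod_cast hK.ne'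
  have hA : ∏ j ∈ range K, (w / 2 + j) ≠ 0 := Finset.prod_ne_zero_iff.2 fun j _ => by
    rw [add_comm]; exact natCast_add_ne_zero_of_re_pos h2 j
  have hB : ∏ j ∈ range K, ((w + 1) / 2 + j) ≠ 0 := Finset.prod_ne_zero_iff.2 fun j _ => by
    rw [add_comm]; exact natCast_add_ne_zero_of_re_pos h3 j
  have hR : alternatingProd w K =
      (∏ j ∈ range K, (w / 2 + j)) / ∏ j ∈ range K, ((w + 1) / 2 + j) := by
    rw [alternatingProd, ← prod_div_distrib]
    refine prod_congr rfl fun j _ => ?_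
    rw [show 2 * (j : ℂ) + w = 2 * (w / 2 + j) by ring,
      show 2 * (j : ℂ) + 1 + w = 2 * ((w + 1) / 2 + j) by ring,
      mul_div_mul_left _ _ two_ne_zero]
  have hsq : (K : ℂ) ^ ((w + 1) / 2) = ((√(K : ℝ) : ℝ) : ℂ) * (K : ℂ) ^ (w / 2) := by
    rw [Real.sqrt_eq_rpow, Complex.ofReal_cpow (Nat.cast_nonneg K), Complex.ofReal_natCast,
      ← Complex.cpow_add _ _ hK0]
    congr 1
    push_cast
    ring
  have hc : (K : ℂ) ^ (w / 2) ≠ 0 := by simp [Complex.cpow_eq_zero_iff, hK0]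
  have hf : (K.factorial : ℂ) ≠ 0 := by exact_mod_cast K.factorial_ne_zero
  have e2 := natCast_add_ne_zero_of_re_pos h2 K
  have e3 := natCast_add_ne_zero_of_re_pos h3 K
  simp only [Pi.div_apply]
  rw [Complex.GammaSeq, Complex.GammaSeq, prod_range_succ, prod_range_succ, hR, hsq,
    add_comm (w / 2) (K : ℂ), add_comm ((w + 1) / 2) (K : ℂ)]
  generalize (K : ℂ) + w / 2 = p at *
  generalize (K : ℂ) + (w + 1) / 2 = q at *
  field_simp

theorem prod_Icc_two_mul_eq_alternatingProd {z : ℂ} (hz : 0 < z.re) (K : ℕ) :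
    ∏ m ∈ Icc 1 (2 * K), (1 + z / (m : ℂ)) ^ ((-1 : ℤ) ^ (m + 1)) =
      alternatingProd (z + 1) K / alternatingProd 1 K := by
  induction K with
  | zero => simp [alternatingProd]
  | succ K ih =>
    have h1 := natCast_add_ne_zero_of_re_pos hz (2 * K + 1)
    have h2 := natCast_add_ne_zero_of_re_pos hz (2 * K + 2)
    have h3 : (2 * K + 1 : ℂ) ≠ 0 := by exact_mod_cast (2 * K).succ_ne_zero
    have h4 : (2 * K + 1 + 1 : ℂ) ≠ 0 := by exact_mod_cast (2 * K + 1).succ_ne_zero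
    rw [show 2 * (K + 1) = 2 * K + 1 + 1 by ring, prod_Icc_succ_top (by omega),
      prod_Icc_succ_top (by omega), ih, alternatingProd, alternatingProd, alternatingProd,
      alternatingProd, prod_range_succ, prod_range_succ]
    have o1 : (-1 : ℤ) ^ (2 * K + 1 + 1) = 1 := Even.neg_one_pow ⟨K + 1, by ring⟩
    have o2 : (-1 : ℤ) ^ (2 * K + 1 + 1 + 1) = -1 := Odd.neg_one_pow ⟨K + 1, by ring⟩
    rw [o1, o2, zpow_one, zpow_neg_one, mul_assoc, mul_div_mul_comm]
    congr 1
    push_cast at h1 h2 ⊢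
    have h5 : (2 * K + 1 + 1 + z : ℂ) ≠ 0 := by convert h2 using 1; ring
    rw [one_add_div h3, one_add_div h4, show 2 * (K : ℂ) + (z + 1) = 2 * K + 1 + z by ring,
      show 2 * (K : ℂ) + 1 + (z + 1) = 2 * K + 1 + 1 + z by ring]
    field_simp

theorem tendsto_prod_Icc_one_add_div {z : ℂ} (hz : 0 < z.re) :
    Tendsto (fun N : ℕ => ∏ m ∈ Icc 1 N, (1 + z / (m : ℂ)) ^ ((-1 : ℤ) ^ (m + 1))) atTop
      (𝓝 (√Real.pi * (z / 2) * Complex.Gamma (z / 2) / Complex.Gamma ((z + 1) / 2))) := by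
  have hz1 : 0 < (z + 1).re := by
    simp
    linarith
  have hz2 : z / 2 ≠ 0 := by
    intro h
    have : z = 0 := by simpa using h
    simp [this] at hz
  have hΓ1 := Complex.Gamma_ne_zero_of_re_pos (s := (1 : ℂ) / 2) (by simp)
  have hev := (tendsto_sqrt_mul_alternatingProd hz1).div
    (tendsto_sqrt_mul_alternatingProd (w := 1) (by simp))
    (div_ne_zero (Complex.Gamma_ne_zero_of_re_pos (by simp)) hΓ1)
  have hlim : Complex.Gamma ((z + 1 + 1) / 2) / Complex.Gamma ((z + 1) / 2) /
      (Complex.Gamma ((1 + 1) / 2) / Complex.Gamma (1 / 2)) =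
      √Real.pi * (z / 2) * Complex.Gamma (z / 2) / Complex.Gamma ((z + 1) / 2) := by
    rw [show (z + 1 + 1) / 2 = z / 2 + 1 by ring, Complex.Gamma_add_one _ hz2,
      show ((1 : ℂ) + 1) / 2 = 1 by norm_num, Complex.Gamma_one, Complex.Gamma_one_half_eq,
      Real.sqrt_eq_rpow, Complex.ofReal_cpow Real.pi_pos.le]
    push_cast
    have := Complex.Gamma_ne_zero_of_re_pos (s := (z + 1) / 2) (by simp; linarith)
    field_simp
  rw [hlim] at hev
  have hev' : Tendsto (fun K : ℕ => ∏ m ∈ Icc 1 (2 * K),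
      (1 + z / (m : ℂ)) ^ ((-1 : ℤ) ^ (m + 1))) atTop
      (𝓝 (√Real.pi * (z / 2) * Complex.Gamma (z / 2) / Complex.Gamma ((z + 1) / 2))) := by
    refine hev.congr' ?_
    filter_upwards [eventually_gt_atTop 0] with K hK
    have : ((√(K : ℝ) : ℝ) : ℂ) ≠ 0 := by
      exact_mod_cast (Real.sqrt_pos.2 (Nat.cast_pos.2 hK)).ne'
    rw [prod_Icc_two_mul_eq_alternatingProd hz, Pi.div_apply, mul_div_mul_left _ _ this]
  refine tendsto_of_tendsto_two_mul hev' ?_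
  have hone : Tendsto (fun K : ℕ => 1 + z / ((2 * K + 1 : ℕ) : ℂ)) atTop (𝓝 1) := by
    have : Tendsto (fun K : ℕ => 2 * K + 1) atTop atTop :=
      tendsto_atTop_mono (fun K => (by omega : K ≤ 2 * K + 1)) tendsto_id
    simpa using ((tendsto_const_div_atTop_nhds_zero_nat (𝕜 := ℂ) z).comp this).const_add 1
  have := hev'.mul hone
  rw [mul_one] at this
  refine this.congr fun K => ?_
  have o1 : (-1 : ℤ) ^ (2 * K + 1 + 1) = 1 := Even.neg_one_pow ⟨K + 1, by ring⟩
  rw [prod_Icc_succ_top (by omega), o1, zpow_one]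

theorem gammaTilde_eq_of_re_pos {z : ℂ} (hz : 0 < z.re) :
    gammaTilde z = √Real.pi / 2 * Complex.Gamma (z / 2) / Complex.Gamma ((z + 1) / 2) := by
  have hz0 : z ≠ 0 := by
    rintro rfl
    simp at hz
  have hexp : ∀ N : ℕ, ∏ m ∈ Icc 1 N, Complex.exp (-z / (m : ℂ)) ^ ((-1 : ℤ) ^ (m + 1)) =
      Complex.exp (-z * ((∑ m ∈ range N, (-1 : ℝ) ^ m / (m + 1) : ℝ) : ℂ)) := by
    intro N
    induction N with
    | zero => simp
    | succ N ih =>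
      rw [prod_Icc_succ_top (by omega), ih, sum_range_succ, ← Complex.exp_int_mul,
        ← Complex.exp_add]
      congr 1
      push_cast
      ring
  have hlim : Tendsto (fun N : ℕ => ∏ m ∈ Icc 1 N,
      (Complex.exp (-z / (m : ℂ)) * (1 + z / (m : ℂ))) ^ ((-1 : ℤ) ^ (m + 1))) atTop
      (𝓝 (Complex.exp (-z * (gammaTilde0 : ℂ)) *
        (√Real.pi * (z / 2) * Complex.Gamma (z / 2) / Complex.Gamma ((z + 1) / 2)))) := by
    simp_rw [mul_zpow, prod_mul_distrib, hexp]
    refine Tendsto.mul ?_ (tendsto_prod_Icc_one_add_div hz)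
    exact (Complex.continuous_exp.tendsto _).comp
      (((Complex.continuous_ofReal.tendsto _).comp
        tendsto_alternating_harmonic_gammaTilde0).const_mul _)
  have hE : Complex.exp ((gammaTilde0 : ℂ) * z) * Complex.exp (-z * (gammaTilde0 : ℂ)) = 1 := by
    rw [← Complex.exp_add, ← Complex.exp_zero]
    congr 1
    ring
  rw [gammaTilde, hlim.limUnder_eq, mul_assoc, ← mul_assoc (Complex.exp _), hE, one_mul]
  field_simp

theorem tendsto_sqrt_mul_alternatingProd_gammaTilde {z : ℂ} (hz : 0 < z.re) :
    Tendsto (fun K : ℕ => ((√(K : ℝ) : ℝ) : ℂ) * alternatingProd z K) atTop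
      (𝓝 (√Real.pi / 2 / gammaTilde z)) := by
  convert tendsto_sqrt_mul_alternatingProd hz using 2
  have h1 := Complex.Gamma_ne_zero_of_re_pos (s := (z + 1) / 2) (by simp; linarith)
  have h2 := Complex.Gamma_ne_zero_of_re_pos (s := z / 2) (by simpa using hz)
  have h3 : ((√Real.pi : ℝ) : ℂ) ≠ 0 := by exact_mod_cast (Real.sqrt_pos.2 Real.pi_pos).ne'
  rw [gammaTilde_eq_of_re_pos hz]
  field_simp

/-- If `‖f''‖ ≤ D` on `[u, u + 2]`, then the second difference of `f` at `u` has norm at most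
`D`. -/
theorem norm_second_difference_le_s3 {f f' f'' : ℝ → ℂ} {u D : ℝ}
    (hf : ∀ t ∈ Set.Icc u (u + 2), HasDerivAt f (f' t) t)
    (hf' : ∀ t ∈ Set.Icc u (u + 2), HasDerivAt f' (f'' t) t)
    (hD : ∀ t ∈ Set.Icc u (u + 2), ‖f'' t‖ ≤ D) :
    ‖f u - 2 * f (u + 1) + f (u + 2)‖ ≤ D := by
  have h1 : ∀ t ∈ Set.Icc u (u + 1), ‖f' (t + 1) - f' t‖ ≤ D := by
    intro t ht
    have := (convex_Icc u (u + 2)).norm_image_sub_le_of_norm_hasDerivWithin_le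
      (fun t ht => (hf' t ht).hasDerivWithinAt) hD (x := t) (y := t + 1)
      ⟨ht.1, by linarith [ht.2]⟩ ⟨by linarith [ht.1], by linarith [ht.2]⟩
    simpa using this
  have h2 : ∀ t ∈ Set.Icc u (u + 1),
      HasDerivWithinAt (fun t => f (t + 1) - f t) (f' (t + 1) - f' t) (Set.Icc u (u + 1)) t := by
    intro t ht
    have a1 := (hf (t + 1) ⟨by linarith [ht.1], by linarith [ht.2]⟩).comp_add_const t 1
    exact (a1.sub (hf t ⟨ht.1, by linarith [ht.2]⟩)).hasDerivWithinAt
  have := (convex_Icc u (u + 1)).norm_image_sub_le_of_norm_hasDerivWithin_le h2 h1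
    (x := u) (y := u + 1) ⟨le_rfl, by linarith⟩ ⟨by linarith, le_rfl⟩
  simp only [add_sub_cancel_left, norm_one, mul_one] at this
  rw [show u + 1 + 1 = u + 2 by ring] at this
  rwa [show f u - 2 * f (u + 1) + f (u + 2) = f (u + 2) - f (u + 1) - (f (u + 1) - f u) by ring]

/-- The second difference of `m ↦ exp (-s * b m)`. -/
noncomputable def expSecondDiff (b : ℕ → ℝ) (m : ℕ) (s : ℂ) : ℂ :=
  Complex.exp (-s * b m) - 2 * Complex.exp (-s * b (m + 1)) + Complex.exp (-s * b (m + 2))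

/-- The sum of `(-1)^(m+1) * exp (-s * b m)`, accelerated by summing second differences. -/
noncomputable def alternatingContinuation (b : ℕ → ℝ) (s : ℂ) : ℂ :=
  -(1 / 4) * (3 * Complex.exp (-s * b 0) - Complex.exp (-s * b 1) +
    ∑' m, (-1) ^ m * expSecondDiff b m s)

section Continuation

variable {b : ℕ → ℝ} {U : Set ℂ} {v : ℕ → ℝ}

theorem differentiable_alternating_expSecondDiff (b : ℕ → ℝ) (m : ℕ) :
    Differentiable ℂ fun s => (-1) ^ m * expSecondDiff b m s := by
  unfold expSecondDiff
  fun_prop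

theorem norm_alternating_expSecondDiff (b : ℕ → ℝ) (m : ℕ) (s : ℂ) :
    ‖(-1) ^ m * expSecondDiff b m s‖ = ‖expSecondDiff b m s‖ := by
  simp

theorem differentiableOn_alternatingContinuation (hU : IsOpen U) (hv : Summable v)
    (hb : ∀ m, ∀ s ∈ U, ‖expSecondDiff b m s‖ ≤ v m) :
    DifferentiableOn ℂ (alternatingContinuation b) U := by
  unfold alternatingContinuation
  have := Complex.differentiableOn_tsum_of_summable_norm hv
    (fun m => (differentiable_alternating_expSecondDiff b m).differentiableOn (s := U)) hU
    (fun m s hs => (norm_alternating_expSecondDiff b m s).trans_le (hb m s hs))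
  fun_prop

theorem tendsto_alternatingContinuation (hv : Summable v) {s : ℂ} (hs : 0 < s.re)
    (hb : ∀ m, ‖expSecondDiff b m s‖ ≤ v m) (hbtop : Tendsto b atTop atTop) :
    Tendsto (fun N : ℕ => ∑ m ∈ range N, (-1) ^ (m + 1) * Complex.exp (-s * b m)) atTop
      (𝓝 (alternatingContinuation b s)) := by
  have hsum : Summable fun m => (-1) ^ m * expSecondDiff b m s :=
    Summable.of_norm_bounded hv fun m => (norm_alternating_expSecondDiff b m s).trans_le (hb m)
  have h0 : Tendsto (fun N => Complex.exp (-s * b N)) atTop (𝓝 0) := by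
    rw [tendsto_zero_iff_norm_tendsto_zero]
    simp only [Complex.norm_exp, neg_mul, Complex.neg_re, Complex.re_mul_ofReal]
    exact Real.tendsto_exp_neg_atTop_nhds_zero.comp (hbtop.const_mul_atTop hs)
  have h1 : Tendsto (fun N : ℕ => (-1 : ℂ) ^ N *
      (3 * Complex.exp (-s * b N) - Complex.exp (-s * b (N + 1)))) atTop (𝓝 0) := by
    rw [tendsto_zero_iff_norm_tendsto_zero]
    simp only [norm_mul, norm_pow, norm_neg, norm_one, one_pow, one_mul]
    have := ((h0.const_mul 3).sub (h0.comp (tendsto_add_atTop_nat 1))).norm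
    simpa using this
  have := ((hsum.hasSum.tendsto_sum_nat.const_add
    (3 * Complex.exp (-s * b 0) - Complex.exp (-s * b 1))).sub h1).const_mul (-(1 / 4))
  rw [sub_zero] at this
  refine this.congr fun N => ?_
  have hN := sum_alternating_second_difference (fun m => Complex.exp (-s * b m)) N
  simp only [expSecondDiff, pow_succ, mul_neg, mul_one, neg_mul, Finset.sum_neg_distrib] at hN ⊢
  rw [hN]
  ring

theorem tendsto_deriv_alternatingContinuation (hU : IsOpen U) (hv : Summable v)
    (hb : ∀ m, ∀ s ∈ U, ‖expSecondDiff b m s‖ ≤ v m) (h0 : (0 : ℂ) ∈ U) :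
    Tendsto (fun N : ℕ => ((∑ m ∈ range N, (-1) ^ m * b m +
      (-1) ^ N * (3 * b N - b (N + 1)) / 4 : ℝ) : ℂ)) atTop
      (𝓝 (deriv (alternatingContinuation b) 0)) := by
  have hd (m : ℕ) := (differentiable_alternating_expSecondDiff b m).differentiableOn (s := U)
  have hb' : ∀ m, ∀ s ∈ U, ‖(-1) ^ m * expSecondDiff b m s‖ ≤ v m :=
    fun m s hs => (norm_alternating_expSecondDiff b m s).trans_le (hb m s hs)
  have hexp (t : ℝ) : HasDerivAt (fun s : ℂ => Complex.exp (-s * t)) (-t) 0 := by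
    have := ((hasDerivAt_id (0 : ℂ)).neg.mul_const (t : ℂ)).cexp
    simpa using this
  have hterm (m : ℕ) : HasDerivAt (fun s => (-1) ^ m * expSecondDiff b m s)
      ((-1) ^ m * (-(b m : ℂ) - 2 * -(b (m + 1) : ℂ) + -(b (m + 2) : ℂ))) 0 :=
    (((hexp (b m)).sub ((hexp (b (m + 1))).const_mul 2)).add (hexp (b (m + 2)))).const_mul _
  have hsum := Complex.hasSum_deriv_of_summable_norm hv hd hU hb' h0
  have hdiff := (Complex.differentiableOn_tsum_of_summable_norm hv hd hU hb').differentiableAt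
    (hU.mem_nhds h0)
  have hder := ((((hexp (b 0)).const_mul 3).sub (hexp (b 1))).add hdiff.hasDerivAt).const_mul
    (-(1 / 4))
  have hder' : deriv (alternatingContinuation b) 0 = _ := hder.deriv
  rw [hder']
  simp_rw [fun m => (hterm m).deriv] at hsum
  refine ((hsum.tendsto_sum_nat.const_add _).const_mul _).congr fun N => ?_
  have hN := sum_alternating_second_difference (fun m => -(b m : ℂ)) N
  simp only [mul_neg, Finset.sum_neg_distrib] at hN ⊢
  rw [hN]
  push_cast
  ring

end Continuation

theorem exists_pow_sub_bounds {n : ℕ} {x c : ℝ} (hx : 0 < x) (hc : |c| < x ^ n) :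
    ∃ ρ : ℝ, 1 ≤ ρ ∧ ∀ u, x ≤ u →
      0 < u ^ n - c ∧ u ^ n ≤ ρ * (u ^ n - c) ∧ u ^ n - c ≤ ρ * u ^ n := by
  have hxn : 0 < x ^ n := pow_pos hx n
  obtain ⟨κ, hκ⟩ : ∃ κ, κ = |c| / x ^ n := ⟨_, rfl⟩
  have hκ0 : 0 ≤ κ := hκ ▸ by positivity
  have hκ1 : κ < 1 := by rwa [hκ, div_lt_one hxn]
  have hκc : |c| = κ * x ^ n := by rw [hκ, div_mul_cancel₀ _ hxn.ne']
  have hρ : 2 ≤ 2 / (1 - κ) := by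
    rw [le_div_iff₀ (by linarith)]
    linarith
  refine ⟨2 / (1 - κ), by linarith, fun u hu => ?_⟩
  have hun : x ^ n ≤ u ^ n := pow_le_pow_left₀ hx.le hu n
  have hcu : |c| ≤ κ * u ^ n := hκc ▸ mul_le_mul_of_nonneg_left hun hκ0
  have hc1 := le_abs_self c
  have hc2 := neg_abs_le c
  refine ⟨by linarith, ?_, ?_⟩
  · rw [div_mul_eq_mul_div, le_div_iff₀ (by linarith)]
    nlinarith
  · nlinarith

theorem hasDerivAt_log_pow_sub {n : ℕ} {c t : ℝ} (ht : 0 < t) (hc : 0 < t ^ n - c) :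
    HasDerivAt (fun t => Real.log (t ^ n - c)) (n / t * (t ^ n / (t ^ n - c))) t := by
  convert ((hasDerivAt_pow n t).sub_const c).log hc.ne' using 1
  cases n with
  | zero => simp
  | succ n =>
    rw [Nat.add_sub_cancel, pow_succ]
    field_simp

theorem hasDerivAt_deriv_log_pow_sub {n : ℕ} {c t : ℝ} (ht : 0 < t) (hc : 0 < t ^ n - c) :
    HasDerivAt (fun t => n / t * (t ^ n / (t ^ n - c)))
      (-(n / t ^ 2) * (t ^ n / (t ^ n - c)) -
        n ^ 2 / t ^ 2 * (t ^ n / (t ^ n - c)) * (t ^ n / (t ^ n - c) - 1)) t := by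
  have h1 : HasDerivAt (fun t : ℝ => n / t) (-(n / t ^ 2)) t := by
    simpa [div_eq_mul_inv] using (hasDerivAt_inv ht.ne').const_mul (n : ℝ)
  have h2 := (hasDerivAt_pow n t).div ((hasDerivAt_pow n t).sub_const c) hc.ne'
  have hn : (n : ℝ) * t ^ (n - 1) = n * t ^ n / t := by
    cases n with
    | zero => simp
    | succ n =>
      rw [Nat.add_sub_cancel, pow_succ]
      field_simp
  refine (h1.mul h2).congr_deriv ?_
  simp only [hn, Pi.div_apply]
  field_simp
  ring

theorem exists_norm_expSecondDiff_le {n : ℕ} {x c : ℝ} (hx : 0 < x) (hc : |c| < x ^ n)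
    {σ M : ℝ} (hσ : 0 ≤ 2 + n * σ) (hσM : |σ| ≤ M) :
    ∃ B : ℝ, ∀ m : ℕ, ∀ s : ℂ, σ ≤ s.re → ‖s‖ ≤ M →
      ‖expSecondDiff (fun m => Real.log ((m + x) ^ n - c)) m s‖ ≤
        B * (1 / |(m : ℝ) + x| ^ (2 + n * σ)) := by
  obtain ⟨ρ, hρ1, hρ⟩ := exists_pow_sub_bounds hx hc
  have hM : 0 ≤ M := (abs_nonneg σ).trans hσM
  set D : ℝ := M * (n * ρ + n ^ 2 * ρ * (ρ + 1)) + M ^ 2 * (n * ρ) ^ 2 with hDdef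
  have hD : 0 ≤ D := by positivity
  set E : ℝ := M * Real.log ρ + 2 * M * n * |Real.log x| with hEdef
  refine ⟨D * Real.exp E, fun m s hs hsM => ?_⟩
  set A : ℝ → ℝ := fun t => Real.log (t ^ n - c) with hA
  set A' : ℝ → ℝ := fun t => n / t * (t ^ n / (t ^ n - c)) with hA'
  set A'' : ℝ → ℝ := fun t => -(n / t ^ 2) * (t ^ n / (t ^ n - c)) -
        n ^ 2 / t ^ 2 * (t ^ n / (t ^ n - c)) * (t ^ n / (t ^ n - c) - 1) with hA''
  have hm0 : (0 : ℝ) ≤ m := Nat.cast_nonneg m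
  have hu : 0 < (m : ℝ) + x := by linarith
  have hre : |s.re| ≤ M := (Complex.abs_re_le_norm s).trans hsM
  have hdA : ∀ t, x ≤ t → HasDerivAt A (A' t) t := fun t ht =>
    hasDerivAt_log_pow_sub (hx.trans_le ht) (hρ t ht).1
  have hdA' : ∀ t, x ≤ t → HasDerivAt A' (A'' t) t := fun t ht =>
    hasDerivAt_deriv_log_pow_sub (hx.trans_le ht) (hρ t ht).1
  have hdf : ∀ t, x ≤ t → HasDerivAt (fun t => Complex.exp (-s * A t))
      (-s * A' t * Complex.exp (-s * A t)) t := by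
    intro t ht
    exact ((hdA t ht).ofReal_comp.const_mul (-s)).cexp.congr_deriv (by ring)
  have hdf' : ∀ t, x ≤ t → HasDerivAt (fun t => -s * A' t * Complex.exp (-s * A t))
      ((-s * A'' t + s ^ 2 * A' t ^ 2) * Complex.exp (-s * A t)) t := by
    intro t ht
    exact (((hdA' t ht).ofReal_comp.const_mul (-s)).mul (hdf t ht)).congr_deriv (by ring)
  have hbound : ∀ t, x ≤ t →
      ‖(-s * A'' t + s ^ 2 * A' t ^ 2) * Complex.exp (-s * A t)‖ ≤
        D * Real.exp E * (1 / t ^ (2 + n * σ)) := by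
    intro t ht
    have ht0 : 0 < t := hx.trans_le ht
    obtain ⟨h1, h2, h3⟩ := hρ t ht
    have htn : 0 < t ^ n := pow_pos ht0 n
    set r := t ^ n / (t ^ n - c) with hr
    have hr0 : 0 ≤ r := by positivity
    have hrρ : r ≤ ρ := by rwa [hr, div_le_iff₀ h1]
    have hr1 : |r - 1| ≤ ρ + 1 := abs_le.2 ⟨by linarith, by linarith⟩
    have bA' : |A' t| ≤ n * ρ / t := by
      change |n / t * r| ≤ _
      rw [abs_of_nonneg (by positivity), div_mul_eq_mul_div]
      gcongr
    have bA'' : |A'' t| ≤ (n * ρ + n ^ 2 * ρ * (ρ + 1)) / t ^ 2 := by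
      change |-(n / t ^ 2) * r - n ^ 2 / t ^ 2 * r * (r - 1)| ≤ _
      refine (abs_sub _ _).trans ?_
      rw [abs_mul, abs_neg, abs_mul (_ * r), abs_of_nonneg (by positivity : 0 ≤ (n : ℝ) / t ^ 2),
        abs_of_nonneg hr0, abs_of_nonneg (by positivity : 0 ≤ (n : ℝ) ^ 2 / t ^ 2 * r), add_div,
        mul_div_right_comm, mul_div_right_comm, mul_div_right_comm ((n : ℝ) ^ 2)]
      gcongr
    have b1 : ‖-s * A'' t + s ^ 2 * A' t ^ 2‖ ≤ D / t ^ 2 := by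
      refine (norm_add_le _ _).trans ?_
      rw [norm_mul, norm_neg, norm_mul, norm_pow, norm_pow, Complex.norm_real, Complex.norm_real,
        Real.norm_eq_abs, Real.norm_eq_abs]
      calc ‖s‖ * |A'' t| + ‖s‖ ^ 2 * |A' t| ^ 2
          ≤ M * ((n * ρ + n ^ 2 * ρ * (ρ + 1)) / t ^ 2) + M ^ 2 * (n * ρ / t) ^ 2 := by
            gcongr
        _ = D / t ^ 2 := by
            rw [hDdef, div_pow]
            ring
    have hlogA : |A t - n * Real.log t| ≤ Real.log ρ := by
      have l1 := Real.log_le_log htn h2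
      have l2 := Real.log_le_log h1 h3
      rw [Real.log_mul (by linarith) h1.ne', Real.log_pow] at l1
      rw [Real.log_mul (by linarith) htn.ne', Real.log_pow] at l2
      rw [abs_le]
      constructor <;> simp only [hA] <;> linarith
    have b2 : -(s.re * A t) ≤ E - n * σ * Real.log t := by
      have e1 : -(s.re * (A t - n * Real.log t)) ≤ M * Real.log ρ := by
        refine (neg_le_abs _).trans ?_
        rw [abs_mul]
        gcongr
      have e2 : -((s.re - σ) * (n * Real.log t)) ≤ 2 * M * n * |Real.log x| := by
        have hlog : -|Real.log x| ≤ Real.log t :=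
          (neg_abs_le _).trans (Real.log_le_log hx ht)
        have g1 : s.re - σ ≤ 2 * M := by
          linarith [le_abs_self s.re, neg_abs_le σ]
        have g2 : 0 ≤ s.re - σ := by linarith
        calc -((s.re - σ) * (n * Real.log t)) = (s.re - σ) * (n * -Real.log t) := by ring
          _ ≤ (s.re - σ) * (n * |Real.log x|) := by
              gcongr
              linarith
          _ ≤ 2 * M * (n * |Real.log x|) := by gcongr
          _ = _ := by ring
      rw [hEdef]
      linarith
    have b3 : ‖Complex.exp (-s * A t)‖ ≤ Real.exp E * (1 / t ^ (n * σ)) := by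
      rw [Complex.norm_exp, neg_mul, Complex.neg_re, Complex.re_mul_ofReal,
        Real.rpow_def_of_pos ht0, one_div, ← Real.exp_neg, ← Real.exp_add]
      gcongr
      linarith
    rw [norm_mul, Real.rpow_add ht0, Real.rpow_two]
    calc _ ≤ D / t ^ 2 * (Real.exp E * (1 / t ^ (n * σ))) := by gcongr
      _ = _ := by field_simp
  have key := norm_second_difference_le_s3 (u := m + x) (D := D * Real.exp E *
    (1 / ((m : ℝ) + x) ^ (2 + n * σ))) (fun t ht => hdf t (by linarith [ht.1]))
    (fun t ht => hdf' t (by linarith [ht.1])) (fun t ht => by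
      refine (hbound t (by linarith [ht.1])).trans ?_
      have := ht.1
      gcongr)
  have e1 : ((m + 1 : ℕ) : ℝ) + x = m + x + 1 := by
    push_cast
    ring
  have e2 : ((m + 2 : ℕ) : ℝ) + x = m + x + 2 := by
    push_cast
    ring
  simpa only [abs_of_pos hu, expSecondDiff, e1, e2] using key

theorem exists_isOpen_summable_bound {n : ℕ} (hn : 1 ≤ n) {x c : ℝ} (hx : 0 < x)
    (hc : |c| < x ^ n) {s₀ : ℂ} (hs₀ : -(1 / (n : ℝ)) < s₀.re) :
    ∃ (U : Set ℂ) (v : ℕ → ℝ), IsOpen U ∧ s₀ ∈ U ∧ Summable v ∧ ∀ m, ∀ s ∈ U,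
      ‖expSecondDiff (fun m => Real.log ((m + x) ^ n - c)) m s‖ ≤ v m := by
  obtain ⟨σ, h1, h2⟩ := exists_between hs₀
  have hn0 : (0 : ℝ) < n := by exact_mod_cast hn
  have hσ : 1 < 2 + n * σ := by
    have := mul_lt_mul_of_pos_left h1 hn0
    rw [mul_neg, mul_one_div_cancel hn0.ne'] at this
    linarith
  obtain ⟨B, hB⟩ := exists_norm_expSecondDiff_le hx hc (by linarith : 0 ≤ 2 + n * σ)
    (le_max_left |σ| (‖s₀‖ + 1))
  refine ⟨{s | σ < s.re} ∩ Metric.ball 0 (max |σ| (‖s₀‖ + 1)), _,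
    (isOpen_lt continuous_const Complex.continuous_re).inter Metric.isOpen_ball,
    ⟨h2, ?_⟩, ((Real.summable_one_div_nat_add_rpow x _).2 hσ).mul_left B, fun m s hs =>
      hB m s (le_of_lt hs.1) (mem_ball_zero_iff.1 hs.2).le⟩
  rw [mem_ball_zero_iff]
  exact (lt_add_one _).trans_le (le_max_right _ _)

theorem tendsto_log_pow_sub_sub_log {n : ℕ} (hn : 1 ≤ n) {x c : ℝ}
    (hpos : ∀ m : ℕ, 0 < ((m : ℝ) + x) ^ n - c) :
    Tendsto (fun m : ℕ => Real.log ((m + x) ^ n - c) - n * Real.log m) atTop (𝓝 0) := by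
  have h1 : Tendsto (fun m : ℕ => (1 + x / (m : ℝ)) ^ n - c / (m : ℝ) ^ n) atTop (𝓝 1) := by
    have a := ((tendsto_const_div_atTop_nhds_zero_nat x).const_add 1).pow n
    have b : Tendsto (fun m : ℕ => c / (m : ℝ) ^ n) atTop (𝓝 0) :=
      tendsto_const_nhds.div_atTop ((tendsto_pow_atTop (by omega)).comp tendsto_natCast_atTop_atTop)
    simpa using a.sub b
  have h2 := h1.log one_ne_zero
  rw [Real.log_one] at h2
  refine h2.congr' ?_
  filter_upwards [eventually_gt_atTop 0] with m hm
  have hm0 : (0 : ℝ) < m := Nat.cast_pos.2 hm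
  rw [← Real.log_pow, ← Real.log_div (hpos m).ne' (by positivity), sub_div, ← div_pow, add_div,
    div_self hm0.ne']

theorem prod_map_nthRoots_one {n : ℕ} (hn : 1 ≤ n) (f : ℂ → ℂ) :
    ((Polynomial.nthRoots n (1 : ℂ)).map f).prod =
      ∏ ζ ∈ Polynomial.nthRootsFinset n (1 : ℂ), f ζ := by
  classical
  have h := Complex.isPrimitiveRoot_exp n (by omega)
  rw [Finset.prod, Polynomial.nthRootsFinset_def, Multiset.toFinset_val,
    Multiset.dedup_eq_self.2 h.nthRoots_one_nodup]

theorem re_sub_mul_pos_of_mem_nthRootsFinset {n : ℕ} (hn : 1 ≤ n) {x y : ℝ} (hxy : |y| < x)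
    {ζ : ℂ} (hζ : ζ ∈ Polynomial.nthRootsFinset n (1 : ℂ)) : 0 < ((x : ℂ) - ζ * y).re := by
  have h1 : ‖ζ‖ = 1 :=
    Complex.norm_eq_one_of_pow_eq_one ((Polynomial.mem_nthRootsFinset hn 1).1 hζ) (by omega)
  have h2 : |(ζ * (y : ℂ)).re| ≤ |y| := by
    simpa [h1] using Complex.abs_re_le_norm (ζ * (y : ℂ))
  rw [Complex.sub_re, Complex.ofReal_re]
  linarith [le_abs_self (ζ * (y : ℂ)).re]

theorem exp_alternating_sum_log_eq_prod_alternatingProd {n : ℕ} (hn : 1 ≤ n) {x y : ℝ}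
    (hpos : ∀ m : ℕ, 0 < ((m : ℝ) + x) ^ n - y ^ n) (K : ℕ) :
    Complex.exp ((∑ m ∈ range (2 * K), (-1) ^ m * Real.log ((m + x) ^ n - y ^ n) : ℝ) : ℂ) =
      ∏ ζ ∈ Polynomial.nthRootsFinset n (1 : ℂ), alternatingProd (x - ζ * y) K := by
  have hexp (m : ℕ) : ((Real.exp (Real.log ((m + x) ^ n - y ^ n)) : ℝ) : ℂ) =
      ∏ ζ ∈ Polynomial.nthRootsFinset n (1 : ℂ), (m + (x - ζ * y)) := by
    rw [Real.exp_log (hpos m)]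
    push_cast
    rw [(Complex.isPrimitiveRoot_exp n (by omega)).pow_sub_pow_eq_prod_sub_mul _ _ (by omega)]
    exact prod_congr rfl fun ζ _ => by ring
  induction K with
  | zero => simp [alternatingProd]
  | succ K ih =>
    have o1 : (-1 : ℝ) ^ (2 * K) = 1 := Even.neg_one_pow ⟨K, by ring⟩
    have o2 : (-1 : ℝ) ^ (2 * K + 1) = -1 := Odd.neg_one_pow ⟨K, by ring⟩
    rw [show 2 * (K + 1) = 2 * K + 1 + 1 by ring, sum_range_succ, sum_range_succ, o1, o2,
      one_mul, neg_one_mul, add_assoc, ← sub_eq_add_neg, Complex.ofReal_add, Complex.exp_add, ih,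
      ← Complex.ofReal_exp, Real.exp_sub, Complex.ofReal_div, hexp, hexp, ← prod_div_distrib,
      ← prod_mul_distrib]
    refine prod_congr rfl fun ζ _ => ?_
    rw [alternatingProd, alternatingProd, prod_range_succ]
    push_cast
    rfl

theorem tendsto_exp_log_correction_div_sqrt_pow {n : ℕ} {b : ℕ → ℝ}
    (hb : Tendsto (fun m : ℕ => b m - n * Real.log m) atTop (𝓝 0)) :
    Tendsto (fun K : ℕ => Real.exp ((-1) ^ (2 * K) * (3 * b (2 * K) - b (2 * K + 1)) / 4) /
      √(K : ℝ) ^ n) atTop (𝓝 (√2 ^ n)) := by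
  have t2 : Tendsto (fun K : ℕ => 2 * K) atTop atTop :=
    tendsto_atTop_mono (fun K => (by omega : K ≤ 2 * K)) tendsto_id
  have h1 := hb.comp t2
  have h2 := hb.comp ((tendsto_add_atTop_nat 1).comp t2)
  have h3 := Real.tendsto_log_nat_add_one_sub_log.comp t2
  have h4 := (((h1.const_mul (3 / 4)).sub (h2.const_mul (1 / 4))).sub
    (h3.const_mul ((n : ℝ) / 4))).add_const (n * (Real.log 2 / 2))
  have h5 := h4.rexp
  have hlim : Real.exp (3 / 4 * 0 - 1 / 4 * 0 - (n : ℝ) / 4 * 0 + n * (Real.log 2 / 2)) =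
      √2 ^ n := by
    rw [Real.sqrt_eq_rpow, Real.rpow_def_of_pos two_pos, ← Real.exp_nat_mul]
    congr 1
    ring
  rw [hlim] at h5
  refine h5.congr' ?_
  filter_upwards [eventually_gt_atTop 0] with K hK
  have hK0 : (0 : ℝ) < K := Nat.cast_pos.2 hK
  have o1 : (-1 : ℝ) ^ (2 * K) = 1 := Even.neg_one_pow ⟨K, by ring⟩
  rw [Real.sqrt_eq_rpow, Real.rpow_def_of_pos hK0, ← Real.exp_nat_mul, ← Real.exp_sub, o1]
  congr 1
  simp only [Function.comp_apply]
  push_cast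
  rw [Real.log_mul two_ne_zero hK0.ne']
  ring

theorem exp_deriv_alternatingContinuation {n : ℕ} (hn : 1 ≤ n) {x y : ℝ} (hxy : |y| < x) :
    Complex.exp (deriv (alternatingContinuation fun m => Real.log ((m + x) ^ n - y ^ n)) 0) =
      (√(Real.pi / 2) : ℂ) ^ n /
        ∏ ζ ∈ Polynomial.nthRootsFinset n (1 : ℂ), gammaTilde (x - ζ * y) := by
  have hx : 0 < x := (abs_nonneg y).trans_lt hxy
  have hc : |y ^ n| < x ^ n := by
    rw [abs_pow]
    exact pow_lt_pow_left₀ hxy (abs_nonneg y) (by omega)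
  have hpos (m : ℕ) : 0 < ((m : ℝ) + x) ^ n - y ^ n := by
    obtain ⟨ρ, -, hρ⟩ := exists_pow_sub_bounds hx hc
    exact (hρ _ (le_add_of_nonneg_left (Nat.cast_nonneg m))).1
  obtain ⟨U, v, hU, h0, hv, hb⟩ := exists_isOpen_summable_bound hn hx hc (s₀ := 0) (by
    rw [Complex.zero_re, neg_lt_zero]
    positivity)
  have hcard := (Complex.isPrimitiveRoot_exp n (by omega)).card_nthRootsFinset
  have t2 : Tendsto (fun K : ℕ => 2 * K) atTop atTop :=
    tendsto_atTop_mono (fun K => (by omega : K ≤ 2 * K)) tendsto_id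
  have hL := (Complex.continuous_exp.tendsto _).comp
    ((tendsto_deriv_alternatingContinuation hU hv hb h0).comp t2)
  have hprod := tendsto_finsetProd (Polynomial.nthRootsFinset n (1 : ℂ)) fun ζ hζ =>
    tendsto_sqrt_mul_alternatingProd_gammaTilde (re_sub_mul_pos_of_mem_nthRootsFinset hn hxy hζ)
  have hcorr := (Complex.continuous_ofReal.tendsto _).comp
    (tendsto_exp_log_correction_div_sqrt_pow (tendsto_log_pow_sub_sub_log hn hpos))
  have hR := hprod.mul hcorr
  have hlim : (∏ ζ ∈ Polynomial.nthRootsFinset n (1 : ℂ),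
      √Real.pi / 2 / gammaTilde ((x : ℂ) - ζ * y)) * ((√2 ^ n : ℝ) : ℂ) =
      (√(Real.pi / 2) : ℂ) ^ n /
        ∏ ζ ∈ Polynomial.nthRootsFinset n (1 : ℂ), gammaTilde (x - ζ * y) := by
    have h2 : √(Real.pi / 2) = √Real.pi / 2 * √2 := by
      rw [Real.sqrt_div Real.pi_pos.le]
      field_simp
      rw [Real.sq_sqrt two_pos.le]
    rw [prod_div_distrib, prod_const, hcard, h2]
    push_cast
    rw [mul_pow]
    ring
  rw [hlim] at hR
  refine tendsto_nhds_unique hL (hR.congr' ?_)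
  filter_upwards [eventually_gt_atTop 0] with K hK
  have hK0 : ((√(K : ℝ) : ℝ) : ℂ) ≠ 0 := by
    exact_mod_cast (Real.sqrt_pos.2 (Nat.cast_pos.2 hK)).ne'
  simp only [Function.comp_apply]
  rw [Complex.ofReal_add, Complex.exp_add,
    exp_alternating_sum_log_eq_prod_alternatingProd hn hpos, prod_mul_distrib, prod_const, hcard,
    ← Complex.ofReal_exp, Complex.ofReal_div, Complex.ofReal_pow]
  rw [mul_right_comm, mul_div_cancel₀ _ (pow_ne_zero n hK0), mul_comm]

/-- Kurokawa–Wakayama type formula: for `n ≥ 1` and real `x > |y|`, the series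
`Λ*(s) = ∑_{m=0}^∞ (−1)^{m+1}((m+x)^n − y^n)^{−s}` converges for `Re(s) > 0`, extends
analytically to `{Re(s) > −1/n}`, and for any such continuation `F` one has
`exp(F′(0)) = (√(π/2))^n / ∏_{ζⁿ=1} Γ̃(x − ζy)`, the product running over all
`n`-th roots of unity in `ℂ`. -/
theorem kurokawa_wakayama_type (n : ℕ) (hn : 1 ≤ n) (x y : ℝ) (hxy : |y| < x) :
    (∀ s : ℂ, 0 < s.re → ∃ L : ℂ,
      Tendsto (fun N : ℕ => ∑ m ∈ Finset.range N,
        (-1 : ℂ) ^ (m + 1) * ((((m : ℝ) + x) ^ n - y ^ n : ℝ) : ℂ) ^ (-s))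
        atTop (𝓝 L)) ∧
    (∃ F : ℂ → ℂ, AnalyticOnNhd ℂ F {s : ℂ | -(1 / (n : ℝ)) < s.re} ∧
      ∀ s : ℂ, 0 < s.re →
        Tendsto (fun N : ℕ => ∑ m ∈ Finset.range N,
          (-1 : ℂ) ^ (m + 1) * ((((m : ℝ) + x) ^ n - y ^ n : ℝ) : ℂ) ^ (-s))
          atTop (𝓝 (F s))) ∧
    (∀ F : ℂ → ℂ, AnalyticOnNhd ℂ F {s : ℂ | -(1 / (n : ℝ)) < s.re} →
      (∀ s : ℂ, 0 < s.re →
        Tendsto (fun N : ℕ => ∑ m ∈ Finset.range N,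
          (-1 : ℂ) ^ (m + 1) * ((((m : ℝ) + x) ^ n - y ^ n : ℝ) : ℂ) ^ (-s))
          atTop (𝓝 (F s))) →
      Complex.exp (deriv F 0) =
        ((Real.sqrt (Real.pi / 2) : ℂ)) ^ n /
          ((Polynomial.nthRoots n (1 : ℂ)).map
            (fun ζ => gammaTilde ((x : ℂ) - ζ * (y : ℂ)))).prod) := by
  have hx : 0 < x := (abs_nonneg y).trans_lt hxy
  have hc : |y ^ n| < x ^ n := by
    rw [abs_pow]
    exact pow_lt_pow_left₀ hxy (abs_nonneg y) (by omega)
  have hpos (m : ℕ) : 0 < ((m : ℝ) + x) ^ n - y ^ n := by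
    obtain ⟨ρ, -, hρ⟩ := exists_pow_sub_bounds hx hc
    exact (hρ _ (le_add_of_nonneg_left (Nat.cast_nonneg m))).1
  have hn0 : (0 : ℝ) < n := by exact_mod_cast hn
  have hinv : 0 < 1 / (n : ℝ) := by positivity
  set b : ℕ → ℝ := fun m => Real.log ((m + x) ^ n - y ^ n) with hbdef
  have hcpow (m : ℕ) (s : ℂ) : ((((m : ℝ) + x) ^ n - y ^ n : ℝ) : ℂ) ^ (-s) =
      Complex.exp (-s * b m) := by
    rw [Complex.cpow_def_of_ne_zero (by exact_mod_cast (hpos m).ne'), ← Complex.ofReal_log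
      (hpos m).le, mul_comm]
  have hbtop : Tendsto b atTop atTop := by
    have := (tendsto_log_pow_sub_sub_log hn hpos).add_atTop
      ((Real.tendsto_log_atTop.comp tendsto_natCast_atTop_atTop).const_mul_atTop hn0)
    simpa [hbdef] using this
  have htend : ∀ s : ℂ, 0 < s.re → Tendsto (fun N : ℕ => ∑ m ∈ Finset.range N,
      (-1 : ℂ) ^ (m + 1) * ((((m : ℝ) + x) ^ n - y ^ n : ℝ) : ℂ) ^ (-s)) atTop
      (𝓝 (alternatingContinuation b s)) := by
    intro s hs
    obtain ⟨U, v, -, hsU, hv, hb⟩ :=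
      exists_isOpen_summable_bound hn hx hc (s₀ := s) (by linarith)
    simp_rw [hcpow]
    exact tendsto_alternatingContinuation hv hs (fun m => hb m s hsU) hbtop
  have hopen : IsOpen {s : ℂ | -(1 / (n : ℝ)) < s.re} :=
    isOpen_lt continuous_const Complex.continuous_re
  have hanal : AnalyticOnNhd ℂ (alternatingContinuation b) {s : ℂ | -(1 / (n : ℝ)) < s.re} := by
    refine DifferentiableOn.analyticOnNhd (fun s hs => ?_) hopen
    obtain ⟨U, v, hU, hsU, hv, hb⟩ := exists_isOpen_summable_bound hn hx hc hs
    exact ((differentiableOn_alternatingContinuation hU hv hb).differentiableAt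
      (hU.mem_nhds hsU)).differentiableWithinAt
  refine ⟨fun s hs => ⟨_, htend s hs⟩, ⟨_, hanal, htend⟩, fun F hF hFt => ?_⟩
  have hconn : IsPreconnected {s : ℂ | -(1 / (n : ℝ)) < s.re} :=
    (convex_halfSpace_re_gt _).isPreconnected
  have hev : F =ᶠ[𝓝 1] alternatingContinuation b := by
    filter_upwards [(isOpen_lt continuous_const Complex.continuous_re).mem_nhds
      (show (0 : ℝ) < (1 : ℂ).re by simp)] with s hs
    exact tendsto_nhds_unique (hFt s hs) (htend s hs)
  have heq := hF.eqOn_of_preconnected_of_eventuallyEq hanal hconn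
    (show (1 : ℂ) ∈ {s : ℂ | -(1 / (n : ℝ)) < s.re} by
      rw [Set.mem_ofPred_eq, Complex.one_re]
      linarith) hev
  have hev0 : F =ᶠ[𝓝 0] alternatingContinuation b :=
    heq.eventuallyEq_of_mem (hopen.mem_nhds (by simpa using hinv))
  rw [hev0.deriv_eq, prod_map_nthRoots_one hn]
  exact exp_deriv_alternatingContinuation hn hxy
end
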